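/- Let ρ be the function analytic on a neighborhood of y = 1 with ρ(1) = 1/(e−1) satisfying 1 + ρ(y) = (1 + (e^{yρ(y)} − 1)/y) · ρ(y) · e^{1−ρ(y)}, and set R(y) = ρ(y)/(1 + ρ(y)). For real y > 0, let T(·,y) be the power series in x whose coefficient of x^n/n! is Σ_T y^{β(T)}, the sum ranging over all labelled trees T on {1,…,n}. Then there is ε > 0 such that for every real y with |y − 1| < ε, the radius of convergence of the power series T(·,y) equals R(y); in particular, for y = 1 the radius of convergence equals 1/e. -/

import Mathlib

open scoped Classical BigOperators
open Filter Topology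

noncomputable section

namespace MetricDimPaper

/-- `R` is a resolving set of `G`: every pair of distinct vertices is distinguished by its
vector of (extended, possibly infinite) distances to the vertices of `R`. -/
def Resolves {V : Type*} (G : SimpleGraph V) (R : Set V) : Prop :=
  ∀ u v : V, u ≠ v → ∃ w ∈ R, G.edist u w ≠ G.edist v w

/-- The metric dimension of a graph: the least cardinality of a resolving set, with the
convention that a single isolated vertex has metric dimension 1. -/
def metricDim {V : Type*} (G : SimpleGraph V) : ℕ :=
  if Nat.card V = 1 then 1
  else sInf {m : ℕ | ∃ R : Set V, R.ncard = m ∧ Resolves G R}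

/-- A tree: a connected acyclic graph. -/
def IsTree {V : Type*} (G : SimpleGraph V) : Prop := G.Connected ∧ G.IsAcyclic

/-- degree of a vertex (as `Nat.card` of the neighbor set). -/
def ndeg {V : Type*} (G : SimpleGraph V) (v : V) : ℕ := (G.neighborSet v).ncard

/-- metric dimension as a real number -/
def betaR {n : ℕ} (G : SimpleGraph (Fin n)) : ℝ := (metricDim G : ℝ)

def treeSet (n : ℕ) : Set (SimpleGraph (Fin n)) := {G | IsTree G}

def forestSet (n : ℕ) : Set (SimpleGraph (Fin n)) := {G | G.IsAcyclic}

/-- Expectation of `f` under the uniform distribution on the (finite) set `S` of graphs. -/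
def unifExp {n : ℕ} (S : Set (SimpleGraph (Fin n))) (f : SimpleGraph (Fin n) → ℝ) : ℝ :=
  (∑ᶠ G ∈ S, f G) / (Nat.card ↥S)

/-- Variance of `f` under the uniform distribution on `S`. -/
def unifVar {n : ℕ} (S : Set (SimpleGraph (Fin n))) (f : SimpleGraph (Fin n) → ℝ) : ℝ :=
  unifExp S (fun G => (f G - unifExp S f) ^ 2)

/-- Probability of the event `A` under the uniform distribution on `S`. -/
def unifPr {n : ℕ} (S A : Set (SimpleGraph (Fin n))) : ℝ :=
  (Nat.card ↥(S ∩ A) : ℝ) / (Nat.card ↥S)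

/-- The probability weight of an individual graph in the Erdős–Rényi model `G(n,p)`. -/
def erWeight (n : ℕ) (p : ℝ) (G : SimpleGraph (Fin n)) : ℝ :=
  p ^ (Nat.card ↥G.edgeSet) * (1 - p) ^ (n.choose 2 - Nat.card ↥G.edgeSet)

/-- Expectation of `f` in the Erdős–Rényi model `G(n,p)`. -/
def erExp (n : ℕ) (p : ℝ) (f : SimpleGraph (Fin n) → ℝ) : ℝ :=
  ∑ᶠ G : SimpleGraph (Fin n), erWeight n p G * f G

/-- Variance of `f` in the Erdős–Rényi model `G(n,p)`. -/
def erVar (n : ℕ) (p : ℝ) (f : SimpleGraph (Fin n) → ℝ) : ℝ :=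
  erExp n p (fun G => (f G - erExp n p f) ^ 2)

/-- Probability of the event `A` in the Erdős–Rényi model `G(n,p)`. -/
def erPr (n : ℕ) (p : ℝ) (A : Set (SimpleGraph (Fin n))) : ℝ :=
  ∑ᶠ G ∈ A, erWeight n p G

/-- The cumulative distribution function of the standard normal law. -/
def stdGaussianCDF (x : ℝ) : ℝ :=
  (Real.sqrt (2 * Real.pi))⁻¹ * ∫ t in Set.Iic x, Real.exp (-(t ^ 2) / 2)

/-- The normalized metric dimension `(β - E β)/sqrt (Var β)` for the uniform model on `S`. -/
def normβ {n : ℕ} (S : Set (SimpleGraph (Fin n))) (G : SimpleGraph (Fin n)) : ℝ :=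
  (betaR G - unifExp S betaR) / Real.sqrt (unifVar S betaR)

/-- The normalized metric dimension `(β - E β)/sqrt (Var β)` for the `G(n,p)` model. -/
def erNormβ (n : ℕ) (p : ℝ) (G : SimpleGraph (Fin n)) : ℝ :=
  (betaR G - erExp n p betaR) / Real.sqrt (erVar n p betaR)


/-- The `n`-th coefficient of the exponential generating series `T(·,y)` of labelled trees
counted by metric dimension: `(∑_T y^(β T))/n!`. -/
def treeCoeff (y : ℝ) (n : ℕ) : ℝ :=
  (∑ᶠ T : {G : SimpleGraph (Fin n) // IsTree G}, y ^ metricDim T.1) / (Nat.factorial n : ℝ)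

/-- `p` is the parent map of a tree rooted at `r`. -/
def IsParentMap {V : Type*} (p : V → V) (r : V) : Prop := p r = r ∧ ∀ v, ∃ k, p^[k] v = r

/-- `u` lies in the subtree rooted at `v`. -/
def IsBelow {V : Type*} (p : V → V) (u v : V) : Prop := ∃ k, p^[k] u = v

/-- `u` is a child of `v`. -/
def IsChild {V : Type*} (p : V → V) (u v : V) : Prop := p u = v ∧ u ≠ v

/-- The subtree rooted at `v` is a path having `v` as an end. -/
def IsThread {V : Type*} (p : V → V) (v : V) : Prop :=
  ∀ u, IsBelow p u v → ∀ c c', IsChild p c u → IsChild p c' u → c = c'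

/-- The number of children of `v` whose subtrees are paths hanging from `v`. -/
def numThread {V : Type*} [Fintype V] (p : V → V) (v : V) : ℕ :=
  (Finset.univ.filter fun u => IsChild p u v ∧ IsThread p u).card

/-- The number of children of `v` whose subtrees are not paths hanging from `v`. -/
def numBranch {V : Type*} [Fintype V] (p : V → V) (v : V) : ℕ :=
  (Finset.univ.filter fun u => IsChild p u v ∧ ¬ IsThread p u).card

/-- The number of landmarks which a rooted tree requires besides its root. -/
def cost {V : Type*} [Fintype V] (p : V → V) : ℕ := ∑ v, (numThread p v - 1)

/-- The tree with parent map `p`. -/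
def toGraph {V : Type*} (p : V → V) : SimpleGraph V := SimpleGraph.fromRel fun u v => p u = v

lemma toGraph_adj {V : Type*} {p : V → V} {u v : V} :
    (toGraph p).Adj u v ↔ u ≠ v ∧ (p u = v ∨ p v = u) := by
  simp [toGraph]

lemma IsBelow.refl {V : Type*} {p : V → V} (u : V) : IsBelow p u u := ⟨0, rfl⟩

lemma IsBelow.trans {V : Type*} {p : V → V} {u v w : V} (h : IsBelow p u v)
    (h' : IsBelow p v w) : IsBelow p u w := by
  obtain ⟨a, rfl⟩ := h
  obtain ⟨b, rfl⟩ := h'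
  exact ⟨b + a, Function.iterate_add_apply p b a u⟩

lemma isBelow_parent {V : Type*} (p : V → V) (u : V) : IsBelow p u (p u) := ⟨1, rfl⟩

lemma IsBelow.parent_of_ne {V : Type*} {p : V → V} {u v : V} (h : IsBelow p u v) (hne : u ≠ v) :
    IsBelow p (p u) v := by
  obtain ⟨k, hk⟩ := h
  cases k with
  | zero => exact absurd hk hne
  | succ k => exact ⟨k, hk⟩

lemma IsBelow.total {V : Type*} {p : V → V} {x u v : V} (h : IsBelow p x u)
    (h' : IsBelow p x v) : IsBelow p u v ∨ IsBelow p v u := by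
  obtain ⟨a, rfl⟩ := h
  obtain ⟨b, rfl⟩ := h'
  rcases le_total a b with hab | hab
  · exact .inl ⟨b - a, by rw [← Function.iterate_add_apply]; congr 2; omega⟩
  · exact .inr ⟨a - b, by rw [← Function.iterate_add_apply]; congr 2; omega⟩

namespace IsParentMap

variable {V : Type*} {p : V → V} {r : V}

/-- The distance of a vertex from the root. -/
def depth (h : IsParentMap p r) (v : V) : ℕ := Nat.find (h.2 v)

lemma depth_root (h : IsParentMap p r) : h.depth r = 0 := by
  simp [depth]

lemma depth_of_ne (h : IsParentMap p r) {v : V} (hv : v ≠ r) :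
    h.depth v = h.depth (p v) + 1 := by
  unfold depth
  rw [Nat.find_eq_iff]
  refine ⟨Nat.find_spec (h.2 (p v)), fun n hn hn' => ?_⟩
  cases n with
  | zero => exact hv hn'
  | succ n => exact Nat.find_min (h.2 (p v)) (by omega) hn'

lemma parent_ne (h : IsParentMap p r) {v : V} (hv : v ≠ r) : p v ≠ v := fun e => by
  have := h.depth_of_ne hv
  rw [e] at this
  omega

lemma ne_root_of_isChild (h : IsParentMap p r) {u v : V} (huv : IsChild p u v) : u ≠ r := by
  rintro rfl
  exact huv.2 (h.1.symm.trans huv.1)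

lemma depth_of_isChild (h : IsParentMap p r) {u v : V} (huv : IsChild p u v) :
    h.depth u = h.depth v + 1 := by
  rw [h.depth_of_ne (h.ne_root_of_isChild huv), huv.1]

lemma isBelow_root (h : IsParentMap p r) (v : V) : IsBelow p v r := h.2 v

lemma depth_le_of_isBelow (h : IsParentMap p r) {u v : V} (huv : IsBelow p u v) :
    h.depth v ≤ h.depth u := by
  obtain ⟨k, rfl⟩ := huv
  induction k with
  | zero => rfl
  | succ k ih =>
    rw [Function.iterate_succ_apply']
    by_cases hr : p^[k] u = r
    · rw [hr, h.1, h.depth_root]; omega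
    · have := h.depth_of_ne hr; omega

lemma eq_of_isBelow_of_depth_eq (h : IsParentMap p r) {u v : V} (huv : IsBelow p u v)
    (hd : h.depth u = h.depth v) : u = v := by
  by_contra hne
  have h1 := h.depth_le_of_isBelow (huv.parent_of_ne hne)
  by_cases hr : u = r
  · subst hr
    obtain ⟨k, hk⟩ := huv
    exact hne (by rw [← hk, Function.iterate_fixed h.1])
  · have := h.depth_of_ne hr; omega

lemma not_isBelow_of_isChild (h : IsParentMap p r) {u v : V} (huv : IsChild p u v) :
    ¬ IsBelow p v u := fun hb => by
  have := h.depth_le_of_isBelow hb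
  have := h.depth_of_isChild huv
  omega

lemma not_isBelow_of_ne (h : IsParentMap p r) {c c' v x : V} (hc : IsChild p c v)
    (hc' : IsChild p c' v) (hne : c ≠ c') (hx : IsBelow p x c) : ¬ IsBelow p x c' := fun hx' => by
  have hd : h.depth c = h.depth c' := by rw [h.depth_of_isChild hc, h.depth_of_isChild hc']
  rcases hx.total hx' with hb | hb
  · exact hne (h.eq_of_isBelow_of_depth_eq hb hd)
  · exact hne (h.eq_of_isBelow_of_depth_eq hb hd.symm).symm

/-- To prove a property of adjacent vertices, consider the parent edges. -/
lemma adj_induction {motive : V → V → Prop} (h : IsParentMap p r)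
    (parent : ∀ u, u ≠ r → motive u (p u)) (child : ∀ u, u ≠ r → motive (p u) u) {u v : V}
    (huv : (toGraph p).Adj u v) : motive u v := by
  obtain ⟨hne, rfl | rfl⟩ := toGraph_adj.1 huv
  · exact parent u fun hr => hne (by rw [hr, h.1])
  · exact child v fun hr => hne (by rw [hr, h.1])

lemma adj_parent (h : IsParentMap p r) {u : V} (hu : u ≠ r) : (toGraph p).Adj u (p u) :=
  toGraph_adj.2 ⟨(h.parent_ne hu).symm, .inl rfl⟩

lemma reachable_of_isBelow (h : IsParentMap p r) {u v : V} (huv : IsBelow p u v) :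
    (toGraph p).Reachable u v := by
  obtain ⟨k, rfl⟩ := huv
  induction k with
  | zero => exact .refl _
  | succ k ih =>
    rw [Function.iterate_succ_apply']
    by_cases hr : p^[k] u = r
    · rwa [hr, h.1, ← hr]
    · exact ih.trans (h.adj_parent hr).reachable

lemma connected (h : IsParentMap p r) : (toGraph p).Connected :=
  have : Nonempty V := ⟨r⟩
  ⟨fun u v => (h.reachable_of_isBelow (h.2 u)).trans (h.reachable_of_isBelow (h.2 v)).symm⟩

end IsParentMap

lemma le_add_dist_of_adj {V : Type*} {G : SimpleGraph V} (hG : G.Connected) (φ : V → ℤ)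
    (hφ : ∀ u v, G.Adj u v → φ u ≤ φ v + 1) (u v : V) : φ u ≤ φ v + G.dist u v := by
  obtain ⟨w, hw⟩ := hG.exists_walk_length_eq_dist u v
  rw [← hw]
  clear hw
  induction w with
  | nil => simp
  | cons hadj _ ih =>
    have := hφ _ _ hadj
    rw [SimpleGraph.Walk.length_cons]
    push_cast
    omega

namespace IsParentMap

variable {V : Type*} {p : V → V} {r : V}

lemma dist_eq_of_isBelow (h : IsParentMap p r) {u v : V} (huv : IsBelow p u v) :
    ((toGraph p).dist u v : ℤ) = h.depth u - h.depth v := by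
  apply le_antisymm
  · obtain ⟨k, rfl⟩ := huv
    induction k with
    | zero => simp
    | succ k ih =>
      rw [Function.iterate_succ_apply']
      by_cases hr : p^[k] u = r
      · rwa [show p (p^[k] u) = p^[k] u by rw [hr, h.1]]
      · have h1 := h.depth_of_ne hr
        have h2 := h.connected.dist_triangle (u := u) (v := p^[k] u) (w := p (p^[k] u))
        rw [SimpleGraph.dist_eq_one_iff_adj.2 (h.adj_parent hr)] at h2
        omega
  · have := le_add_dist_of_adj h.connected (fun x => (h.depth x : ℤ)) (fun a b hab => by
      refine h.adj_induction (motive := fun a b => (h.depth a : ℤ) ≤ h.depth b + 1)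
        (fun u hu => ?_) (fun u hu => ?_) hab <;>
      · have := h.depth_of_ne hu
        omega) u v
    omega

lemma dist_root (h : IsParentMap p r) (v : V) : (toGraph p).dist v r = h.depth v := by
  have := h.dist_eq_of_isBelow (h.2 v)
  rw [h.depth_root] at this
  omega

/-- A path leaving the subtree of a child passes through the parent. -/
lemma dist_add_depth_le (h : IsParentMap p r) {c v x y : V} (hc : IsChild p c v)
    (hy : IsBelow p y c) (hx : ¬ IsBelow p x c) :
    (toGraph p).dist v x + h.depth y ≤ (toGraph p).dist y x + h.depth v := by
  have hdc := h.depth_of_isChild hc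
  set D := (toGraph p).dist
  let φ : V → ℤ := fun z => if IsBelow p z c then D v x + h.depth z - h.depth v else D z x
  have hstep : ∀ u, u ≠ r → φ u ≤ φ (p u) + 1 ∧ φ (p u) ≤ φ u + 1 := fun u hu => by
    have h1 := h.depth_of_ne hu
    by_cases huc : u = c
    · subst huc
      have hv : ¬ IsBelow p v u := h.not_isBelow_of_isChild hc
      simp only [φ, hc.1, hv, if_false, IsBelow.refl, if_true]
      omega
    by_cases hb : IsBelow p u c
    · have hb' := hb.parent_of_ne huc
      simp only [φ, hb, hb', if_true]
      omega
    · have hb' : ¬ IsBelow p (p u) c := fun hb' => hb ((isBelow_parent p u).trans hb')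
      simp only [φ, hb, hb', if_false]
      have e1 : D u (p u) = 1 := SimpleGraph.dist_eq_one_iff_adj.2 (h.adj_parent hu)
      have e2 : D (p u) u = 1 := SimpleGraph.dist_eq_one_iff_adj.2 (h.adj_parent hu).symm
      have t1 : D u x ≤ D u (p u) + D (p u) x := h.connected.dist_triangle
      have t2 : D (p u) x ≤ D (p u) u + D u x := h.connected.dist_triangle
      omega
  have := le_add_dist_of_adj h.connected φ (fun a b hab =>
    h.adj_induction (motive := fun a b => φ a ≤ φ b + 1) (fun u hu => (hstep u hu).1)
      (fun u hu => (hstep u hu).2) hab) y x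
  have hxx : D x x = 0 := SimpleGraph.dist_self
  simp only [φ, hy, if_true, hx, if_false, hxx] at this
  change _ ≤ _ + ((D y x : ℕ) : ℤ) at this
  omega

lemma dist_of_not_isBelow (h : IsParentMap p r) {c v x : V} (hc : IsChild p c v)
    (hx : ¬ IsBelow p x c) : (toGraph p).dist c x = (toGraph p).dist v x + 1 := by
  have hdc := h.depth_of_isChild hc
  have h1 := h.dist_add_depth_le hc (.refl c) hx
  have h2 := h.connected.dist_triangle (u := c) (v := v) (w := x)
  have := SimpleGraph.dist_eq_one_iff_adj.2 (h.adj_parent (h.ne_root_of_isChild hc))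
  rw [hc.1] at this
  omega

end IsParentMap

lemma IsBelow.exists_isChild {V : Type*} {p : V → V} {x u : V} (hx : IsBelow p x u)
    (hne : x ≠ u) : ∃ c, IsChild p c u ∧ IsBelow p x c := by
  obtain ⟨k, hk⟩ := hx
  induction k generalizing x with
  | zero => exact absurd hk hne
  | succ k ih =>
    by_cases hp : p x = u
    · exact ⟨x, ⟨hp, hne⟩, .refl x⟩
    · obtain ⟨c, hc, hb⟩ := ih hp hk
      exact ⟨c, hc, (isBelow_parent p x).trans hb⟩

lemma IsThread.of_isBelow {V : Type*} {p : V → V} {u v : V} (h : IsThread p v)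
    (huv : IsBelow p u v) : IsThread p u := fun _ hx => h _ (hx.trans huv)

namespace IsParentMap

variable {V : Type*} {p : V → V} {r : V}

/-- The branching vertex separating two vertices of the same depth. -/
lemma exists_meet (h : IsParentMap p r) {u v : V} (hne : u ≠ v) (hd : h.depth u = h.depth v) :
    ∃ w c c', IsChild p c w ∧ IsChild p c' w ∧ c ≠ c' ∧ IsBelow p u c ∧ IsBelow p v c' := by
  induction hn : h.depth u generalizing u v with
  | zero =>
    have key : ∀ x, h.depth x = 0 → x = r := fun x hx => by
      by_contra hxr
      have := h.depth_of_ne hxr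
      omega
    exact absurd ((key u hn).trans (key v (hd ▸ hn)).symm) hne
  | succ n ih =>
    have key : ∀ x, h.depth x = n + 1 → x ≠ r := fun x hx hxr => by
      have := h.depth_root
      subst hxr
      omega
    have hu := key u hn
    have hv := key v (hd ▸ hn)
    have hdu := h.depth_of_ne hu
    have hdv := h.depth_of_ne hv
    by_cases hp : p u = p v
    · exact ⟨p u, u, v, ⟨rfl, (h.parent_ne hu).symm⟩, ⟨hp.symm, hp ▸ (h.parent_ne hv).symm⟩,
        hne, .refl u, .refl v⟩
    · obtain ⟨w, c, c', hc, hc', hcc, hb, hb'⟩ := ih hp (by omega) (by omega)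
      exact ⟨w, c, c', hc, hc', hcc, (isBelow_parent p u).trans hb,
        (isBelow_parent p v).trans hb'⟩

/-- A set of vertices hitting all but at most one of the child subtrees of every vertex resolves
the tree together with the root. -/
lemma resolves_insert_root (h : IsParentMap p r) {S : Set V}
    (hS : ∀ w c c', IsChild p c w → IsChild p c' w → c ≠ c' →
      (∃ s ∈ S, IsBelow p s c) ∨ ∃ s ∈ S, IsBelow p s c') :
    Resolves (toGraph p) (insert r S) := by
  have key : ∀ u v w c c', h.depth u = h.depth v → IsChild p c w → IsChild p c' w → c ≠ c' →
      IsBelow p u c → IsBelow p v c' → ∀ s, IsBelow p s c →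
      (toGraph p).edist u s ≠ (toGraph p).edist v s := by
    intro u v w c c' hd hc hc' hne hu hv s hs he
    have he' : (toGraph p).dist u s = (toGraph p).dist v s := congrArg ENat.toNat he
    have h1 := h.dist_add_depth_le hc' hv (h.not_isBelow_of_ne hc hc' hne hs)
    have h2 := h.dist_eq_of_isBelow (hs.trans (hc.1 ▸ isBelow_parent p c))
    have h3 := h.connected.dist_triangle (u := u) (v := c) (w := s)
    have h4 := h.dist_eq_of_isBelow hu
    have h5 := h.dist_eq_of_isBelow hs
    have h6 := h.depth_of_isChild hc
    rw [SimpleGraph.dist_comm] at h2 h5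
    omega
  intro u v hne
  by_cases hd : h.depth u = h.depth v
  · obtain ⟨w, c, c', hc, hc', hcc, hu, hv⟩ := h.exists_meet hne hd
    rcases hS w c c' hc hc' hcc with ⟨s, hs, hb⟩ | ⟨s, hs, hb⟩
    · exact ⟨s, .inr hs, key u v w c c' hd hc hc' hcc hu hv s hb⟩
    · exact ⟨s, .inr hs, (key v u w c' c hd.symm hc' hc hcc.symm hv hu s hb).symm⟩
  · refine ⟨r, .inl rfl, fun he => hd ?_⟩
    rw [← h.dist_root, ← h.dist_root]
    exact congrArg ENat.toNat he

lemma exists_resolves [Fintype V] (h : IsParentMap p r) :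
    ∃ R : Set V, R.ncard ≤ cost p + 1 ∧ Resolves (toGraph p) R := by
  let T : V → Finset V := fun v => Finset.univ.filter fun u => IsChild p u v ∧ IsThread p u
  have hT : ∀ u v, u ∈ T v ↔ IsChild p u v ∧ IsThread p u := by simp [T]
  have hsel : ∀ v, ∃ x, (T v).Nonempty → x ∈ T v := fun v => by
    by_cases hv : (T v).Nonempty
    · exact ⟨hv.choose, fun _ => hv.choose_spec⟩
    · exact ⟨v, fun h => absurd h hv⟩
  choose sel hsel using hsel
  let S : Finset V := Finset.univ.filter fun u => u ∈ T (p u) ∧ u ≠ sel (p u)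
  have hSmem : ∀ u v, u ∈ T v → u ≠ sel v → u ∈ S := fun u v hu hne => by
    obtain rfl := ((hT _ _).1 hu).1.1
    exact Finset.mem_filter.2 ⟨Finset.mem_univ u, hu, hne⟩
  have hcard : S.card ≤ cost p := by
    rw [Finset.card_eq_sum_card_fiberwise (f := p) (t := Finset.univ) (fun _ _ => by simp)]
    refine Finset.sum_le_sum fun v _ => ?_
    have hsub : {u ∈ S | p u = v} ⊆ (T v).erase (sel v) := by
      intro u hu
      simp only [S, Finset.mem_filter, Finset.mem_univ, true_and] at hu
      obtain ⟨⟨h1, h2⟩, rfl⟩ := hu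
      exact Finset.mem_erase.2 ⟨h2, h1⟩
    refine (Finset.card_le_card hsub).trans ?_
    by_cases hv : (T v).Nonempty
    · rw [Finset.card_erase_of_mem (hsel v hv)]
      rfl
    · rw [Finset.not_nonempty_iff_eq_empty.1 hv]
      simp
  have hbranch : ∀ c, ¬ IsThread p c → ∃ s ∈ S, IsBelow p s c := by
    intro c hc
    obtain ⟨u, hu, hmax⟩ := Finset.exists_max_image
      (Finset.univ.filter fun u => IsBelow p u c ∧ ¬ IsThread p u) h.depth
      ⟨c, by simpa using ⟨.refl c, hc⟩⟩
    simp only [Finset.mem_filter, Finset.mem_univ, true_and, and_imp] at hu hmax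
    have hthread : ∀ x, IsChild p x u → IsThread p x := fun x hx => by
      by_contra hnt
      have := hmax x ((hx.1 ▸ isBelow_parent p x : IsBelow p x u).trans hu.1) hnt
      have := h.depth_of_isChild hx
      omega
    have hnt := hu.2
    unfold IsThread at hnt
    push Not at hnt
    obtain ⟨x, hx, a, b, ha, hb, hab⟩ := hnt
    obtain rfl : x = u := by
      by_contra hxu
      obtain ⟨d, hd, hxd⟩ := hx.exists_isChild hxu
      exact hab (hthread d hd x hxd a b ha hb)
    have hmem : ∀ y, IsChild p y x → y ≠ sel x → ∃ s ∈ S, IsBelow p s c := fun y hy hne =>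
      ⟨y, hSmem y x ((hT _ _).2 ⟨hy, hthread y hy⟩) hne,
        (hy.1 ▸ isBelow_parent p y : IsBelow p y x).trans hu.1⟩
    by_cases has : a = sel x
    · exact hmem b hb fun hbs => hab (has.trans hbs.symm)
    · exact hmem a ha has
  refine ⟨insert r (S : Set V), ?_, h.resolves_insert_root fun w c c' hc hc' hne => ?_⟩
  · refine (Set.ncard_insert_le _ _).trans ?_
    rw [Set.ncard_coe_finset]
    omega
  · by_cases ht : IsThread p c
    · by_cases ht' : IsThread p c'
      · by_cases hs : c = sel w
        · exact .inr ⟨c', hSmem c' w ((hT _ _).2 ⟨hc', ht'⟩) fun hs' => hne (hs.trans hs'.symm),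
            .refl c'⟩
        · exact .inl ⟨c, hSmem c w ((hT _ _).2 ⟨hc, ht⟩) hs, .refl c⟩
      · exact .inr (hbranch c' ht')
    · exact .inl (hbranch c ht)

lemma cost_le_ncard [Fintype V] (h : IsParentMap p r) {R : Set V}
    (hR : Resolves (toGraph p) R) : cost p ≤ R.ncard := by
  let Q : Finset V := Finset.univ.filter fun u =>
    IsChild p u (p u) ∧ IsThread p u ∧ 2 ≤ numThread p (p u) ∧ ∃ x ∈ R, IsBelow p x u
  have hQR : Q.card ≤ R.ncard := by
    have hx : ∀ u ∈ Q, ∃ x ∈ R, IsBelow p x u := fun u hu => (Finset.mem_filter.1 hu).2.2.2.2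
    choose! f hfR hf using hx
    rw [Set.ncard_eq_toFinset_card']
    refine Finset.card_le_card_of_injOn f (fun u hu => by simpa using hfR u hu) ?_
    have key : ∀ u v, u ∈ Q → v ∈ Q → IsBelow p u v → u = v := fun u v hu hv huv => by
      by_contra hne
      have ht : IsThread p v := (Finset.mem_filter.1 hv).2.2.1
      obtain ⟨a, ha, b, hb, hab⟩ := Finset.one_lt_card.1 (Finset.mem_filter.1 hu).2.2.2.1
      simp only [Finset.mem_filter] at ha hb
      exact hab (ht _ (huv.parent_of_ne hne) a b ha.2.1 hb.2.1)
    intro u hu v hv huv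
    rcases (hf u hu).total (huv ▸ hf v hv) with hb | hb
    · exact key u v hu hv hb
    · exact (key v u hv hu hb).symm
  refine le_trans ?_ hQR
  rw [Finset.card_eq_sum_card_fiberwise (f := p) (t := Finset.univ) (fun _ _ => by simp)]
  refine Finset.sum_le_sum fun v _ => ?_
  by_cases h2 : 2 ≤ numThread p v
  swap
  · omega
  let T : Finset V := Finset.univ.filter fun u => IsChild p u v ∧ IsThread p u
  have hmiss : (T.filter fun u => ¬ ∃ x ∈ R, IsBelow p x u).card ≤ 1 := by
    refine Finset.card_le_one.2 fun a ha b hb => ?_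
    simp only [T, Finset.mem_filter, Finset.mem_univ, true_and] at ha hb
    by_contra hab
    obtain ⟨x, hxR, hx⟩ := hR a b hab
    have e1 := h.dist_of_not_isBelow ha.1.1 fun hb' => ha.2 ⟨x, hxR, hb'⟩
    have e2 := h.dist_of_not_isBelow hb.1.1 fun hb' => hb.2 ⟨x, hxR, hb'⟩
    refine hx ?_
    rw [← (h.connected.preconnected a x).coe_dist_eq_edist,
      ← (h.connected.preconnected b x).coe_dist_eq_edist, e1, e2]
  have hhit : (T.filter fun u => ∃ x ∈ R, IsBelow p x u).card ≤ {u ∈ Q | p u = v}.card := by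
    refine Finset.card_le_card fun u hu => ?_
    simp only [T, Finset.mem_filter, Finset.mem_univ, true_and] at hu
    obtain ⟨⟨hc, ht⟩, hx⟩ := hu
    obtain rfl := hc.1
    simp only [Q, Finset.mem_filter, Finset.mem_univ, true_and, and_true]
    exact ⟨hc, ht, h2, hx⟩
  have hsplit := Finset.card_filter_add_card_filter_not (s := T) fun u => ∃ x ∈ R, IsBelow p x u
  have hTcard : T.card = numThread p v := rfl
  omega

lemma metricDim_le [Fintype V] (h : IsParentMap p r) : metricDim (toGraph p) ≤ cost p + 1 := by
  obtain ⟨R, hR, hres⟩ := h.exists_resolves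
  unfold metricDim
  split_ifs
  · omega
  · exact le_trans (b := R.ncard) (Nat.sInf_le ⟨R, rfl, hres⟩) hR

lemma cost_le_metricDim [Fintype V] (h : IsParentMap p r) : cost p ≤ metricDim (toGraph p) := by
  unfold metricDim
  split_ifs with hcard
  · have : Subsingleton V := (Nat.card_eq_one_iff_unique.1 hcard).1
    have h0 : cost p = 0 := Finset.sum_eq_zero fun v _ => by
      have : numThread p v = 0 := Finset.card_eq_zero.2 <| Finset.filter_eq_empty_iff.2
        fun u _ hu => hu.1.2 (Subsingleton.elim u v)
      omega
    omega
  · obtain ⟨R, -, hres⟩ := h.exists_resolves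
    obtain ⟨R', hR', hres'⟩ := Nat.sInf_mem
      (s := {m : ℕ | ∃ R : Set V, R.ncard = m ∧ Resolves (toGraph p) R}) ⟨_, R, rfl, hres⟩
    rw [← hR']
    exact h.cost_le_ncard hres'

lemma isTree [Finite V] (h : IsParentMap p r) : (toGraph p).IsTree := by
  refine SimpleGraph.isTree_iff_connected_and_card.2 ⟨h.connected, ?_⟩
  have := Fintype.ofFinite V
  refine le_antisymm ?_ h.connected.card_vert_le_card_edgeSet_add_one
  have hsub : (toGraph p).edgeSet ⊆ (fun u => s(u, p u)) '' {u | u ≠ r} := by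
    intro e he
    induction e using Sym2.ind with
    | _ u v =>
      exact h.adj_induction
        (motive := fun u v => s(u, v) ∈ (fun u => s(u, p u)) '' {u | u ≠ r})
        (fun u hu => ⟨u, hu, rfl⟩) (fun u hu => ⟨u, hu, Sym2.eq_swap⟩) he
  have h1 : (toGraph p).edgeSet.ncard ≤ {u | u ≠ r}.ncard :=
    (Set.ncard_le_ncard hsub (Set.toFinite _)).trans (Set.ncard_image_le (Set.toFinite _))
  have h2 : ({u | u ≠ r} : Set V).ncard + 1 = Nat.card V := by
    have := Set.ncard_add_ncard_compl ({r} : Set V)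
    rw [Set.ncard_singleton] at this
    rw [← this, add_comm]
    rfl
  change (toGraph p).edgeSet.ncard + 1 ≤ _
  omega

lemma toGraph_injective {q : V → V} (hp : IsParentMap p r) (hq : IsParentMap q r)
    (h : toGraph p = toGraph q) : p = q := by
  have hd : ∀ v, hp.depth v = hq.depth v := fun v => by
    rw [← hp.dist_root, ← hq.dist_root, h]
  funext v
  by_cases hv : v = r
  · rw [hv, hp.1, hq.1]
  have hadj := hq.adj_parent hv
  rw [← h, toGraph_adj] at hadj
  rcases hadj.2 with h1 | h1
  · exact h1
  · have h2 := hq.depth_of_ne hv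
    have h3 := hp.depth_of_ne (v := q v) (by
      intro hqr
      rw [hqr, hp.1] at h1
      exact hv h1.symm)
    rw [h1] at h3
    have := hd v
    have := hd (q v)
    omega

end IsParentMap

lemma exists_toGraph_eq {V : Type*} [Finite V] {G : SimpleGraph V} (hG : G.IsTree) (r : V) :
    ∃ p, IsParentMap p r ∧ toGraph p = G := by
  have hex : ∀ v, ∃ u, (v = r ∧ u = r) ∨ (v ≠ r ∧ G.Adj v u ∧ G.dist u r + 1 = G.dist v r) := by
    intro v
    by_cases hv : v = r
    · exact ⟨r, .inl ⟨hv, rfl⟩⟩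
    obtain ⟨w, hw⟩ := hG.1.exists_walk_length_eq_dist v r
    cases w with
    | nil => exact absurd rfl hv
    | cons hadj w =>
      rename_i u
      refine ⟨u, .inr ⟨hv, hadj, ?_⟩⟩
      have h1 := SimpleGraph.dist_le w
      have h2 := hG.1.dist_triangle (u := v) (v := u) (w := r)
      rw [SimpleGraph.dist_eq_one_iff_adj.2 hadj] at h2
      rw [SimpleGraph.Walk.length_cons] at hw
      omega
  choose p hp using hex
  have hroot : p r = r := by
    rcases hp r with h | h
    · exact h.2
    · exact absurd rfl h.1
  have hpm : IsParentMap p r := by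
    refine ⟨hroot, fun v => ?_⟩
    induction hn : G.dist v r using Nat.strong_induction_on generalizing v with
    | _ n ih =>
      rcases hp v with h | h
      · exact ⟨0, h.1⟩
      · obtain ⟨k, hk⟩ := ih _ (by omega) (p v) rfl
        exact ⟨k + 1, hk⟩
  refine ⟨p, hpm, ?_⟩
  have hle : toGraph p ≤ G := fun u v huv =>
    hpm.adj_induction (motive := fun u v => G.Adj u v)
      (fun u hu => ((hp u).resolve_left fun h => hu h.1).2.1)
      (fun u hu => ((hp u).resolve_left fun h => hu h.1).2.1.symm) huv
  exact le_antisymm hle ((SimpleGraph.isTree_iff_minimal_connected.1 hG).2 hpm.connected hle)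

lemma sum_isTree_eq {V M : Type*} [Fintype V] [AddCommMonoid M] (f : SimpleGraph V → M) (r : V) :
    ∑ T : {G : SimpleGraph V // IsTree G}, f T.1 =
      ∑ p : {p : V → V // IsParentMap p r}, f (toGraph p.1) := by
  symm
  refine Fintype.sum_bijective (fun p => ⟨toGraph p.1, p.2.isTree.1, p.2.isTree.2⟩) ⟨?_, ?_⟩ _ _
    fun _ => rfl
  · exact fun p q hpq => Subtype.ext (p.2.toGraph_injective q.2 (congrArg Subtype.val hpq))
  · rintro ⟨G, hG⟩
    obtain ⟨p, hp, rfl⟩ := exists_toGraph_eq ⟨hG.1, hG.2⟩ r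
    exact ⟨⟨p, hp⟩, rfl⟩

/-- Rooted trees on the vertex set `V`, as pairs of a root and a parent map. -/
abbrev RootedTree (V : Type*) := {t : V × (V → V) // IsParentMap t.2 t.1}

/-- The contribution to the cost of the vertices other than `r`. -/
def offRootCost {V : Type*} [Fintype V] (p : V → V) (r : V) : ℕ :=
  ∑ v, if v = r then 0 else (numThread p v - 1)

lemma cost_eq_offRootCost_add {V : Type*} [Fintype V] (p : V → V) (r : V) :
    cost p = offRootCost p r + (numThread p r - 1) := by
  have h : ∀ v, numThread p v - 1 =
      (if v = r then 0 else (numThread p v - 1)) + if v = r then numThread p v - 1 else 0 := by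
    intro v
    split_ifs <;> simp
  rw [cost, Finset.sum_congr rfl fun v _ => h v, Finset.sum_add_distrib]
  simp [offRootCost]

/-- The map `i` embeds the children relation of `q` below the vertices satisfying `good` into that
of `p`. -/
structure ChildEmbedding {W V : Type*} (q : W → W) (p : V → V) (i : W → V)
    (good : W → Prop) : Prop where
  inj : Function.Injective i
  isChild_iff : ∀ w, good w → ∀ u, IsChild p u (i w) ↔ ∃ w', i w' = u ∧ IsChild q w' w
  good_child : ∀ w w', good w → IsChild q w' w → good w'

namespace ChildEmbedding

variable {W V : Type*} {q : W → W} {p : V → V} {i : W → V} {good : W → Prop}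

lemma exists_of_isBelow (h : ChildEmbedding q p i good) {w : W} (hw : good w) {u : V}
    (hu : IsBelow p u (i w)) : ∃ w', i w' = u ∧ good w' ∧ IsBelow q w' w := by
  obtain ⟨k, hk⟩ := hu
  induction k generalizing u with
  | zero => exact ⟨w, hk.symm, hw, .refl w⟩
  | succ k ih =>
    obtain ⟨w', hw', hg, hb⟩ := ih hk
    by_cases hp : p u = u
    · exact ⟨w', hw'.trans hp, hg, hb⟩
    · obtain ⟨w'', rfl, hc⟩ :=
        (h.isChild_iff w' hg u).1 ⟨hw'.symm, fun e => hp (hw'.symm.trans e.symm)⟩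
      exact ⟨w'', rfl, h.good_child _ _ hg hc,
        (hc.1 ▸ isBelow_parent q w'' : IsBelow q w'' w').trans hb⟩

lemma isBelow_of_isBelow (h : ChildEmbedding q p i good) {w w' : W} (hw : good w)
    (hb : IsBelow q w' w) : good w' ∧ IsBelow p (i w') (i w) := by
  obtain ⟨k, hk⟩ := hb
  induction k generalizing w' with
  | zero =>
    obtain rfl : w' = w := hk
    exact ⟨hw, .refl _⟩
  | succ k ih =>
    obtain ⟨hg, hb⟩ := ih hk
    by_cases hq : q w' = w'
    · rw [hq] at hg hb
      exact ⟨hg, hb⟩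
    · have hc : IsChild q w' (q w') := ⟨rfl, fun e => hq e.symm⟩
      have hc' := (h.isChild_iff _ hg (i w')).2 ⟨w', rfl, hc⟩
      exact ⟨h.good_child _ _ hg hc, (hc'.1 ▸ isBelow_parent p (i w') :
        IsBelow p (i w') (i (q w'))).trans hb⟩

lemma isThread_iff (h : ChildEmbedding q p i good) {w : W} (hw : good w) :
    IsThread p (i w) ↔ IsThread q w := by
  constructor
  · intro ht x hx c c' hc hc'
    obtain ⟨hg, hb⟩ := h.isBelow_of_isBelow hw hx
    exact h.inj (ht _ hb _ _ ((h.isChild_iff x hg _).2 ⟨c, rfl, hc⟩)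
      ((h.isChild_iff x hg _).2 ⟨c', rfl, hc'⟩))
  · intro ht x hx c c' hc hc'
    obtain ⟨x, rfl, hg, hb⟩ := h.exists_of_isBelow hw hx
    obtain ⟨d, rfl, hd⟩ := (h.isChild_iff x hg _).1 hc
    obtain ⟨d', rfl, hd'⟩ := (h.isChild_iff x hg _).1 hc'
    rw [ht x hb d d' hd hd']

lemma numThread_eq [Fintype W] [Fintype V] (h : ChildEmbedding q p i good) {w : W}
    (hw : good w) : numThread p (i w) = numThread q w := by
  symm
  refine Finset.card_bij (fun u _ => i u) ?_ (fun _ _ _ _ e => h.inj e) ?_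
  · intro u hu
    simp only [Finset.mem_filter, Finset.mem_univ, true_and] at hu ⊢
    exact ⟨(h.isChild_iff w hw _).2 ⟨u, rfl, hu.1⟩,
      (h.isThread_iff (h.good_child _ _ hw hu.1)).2 hu.2⟩
  · intro u hu
    simp only [Finset.mem_filter, Finset.mem_univ, true_and] at hu
    obtain ⟨hc, ht⟩ := hu
    obtain ⟨d, rfl, hd⟩ := (h.isChild_iff w hw _).1 hc
    exact ⟨d, by simpa using ⟨hd, (h.isThread_iff (h.good_child _ _ hw hd)).1 ht⟩, rfl⟩

lemma numBranch_eq [Fintype W] [Fintype V] (h : ChildEmbedding q p i good) {w : W}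
    (hw : good w) : numBranch p (i w) = numBranch q w := by
  symm
  refine Finset.card_bij (fun u _ => i u) ?_ (fun _ _ _ _ e => h.inj e) ?_
  · intro u hu
    simp only [Finset.mem_filter, Finset.mem_univ, true_and] at hu ⊢
    exact ⟨(h.isChild_iff w hw _).2 ⟨u, rfl, hu.1⟩,
      fun ht => hu.2 ((h.isThread_iff (h.good_child _ _ hw hu.1)).1 ht)⟩
  · intro u hu
    simp only [Finset.mem_filter, Finset.mem_univ, true_and] at hu
    obtain ⟨hc, ht⟩ := hu
    obtain ⟨d, rfl, hd⟩ := (h.isChild_iff w hw _).1 hc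
    exact ⟨d, by simpa using
      ⟨hd, fun ht' => ht ((h.isThread_iff (h.good_child _ _ hw hd)).2 ht')⟩, rfl⟩

end ChildEmbedding

section Join

variable {V : Type*} {S : Finset V}

/-- Attach the tree `t₁` on `S` to the root of the tree `t₂` on the complement of `S`. -/
def joinMap (t₁ : RootedTree {v // v ∈ S}) (t₂ : RootedTree {v // v ∉ S}) (v : V) : V :=
  if h : v ∈ S then
    if v = t₁.1.1 then t₂.1.1 else t₁.1.2 ⟨v, h⟩
  else t₂.1.2 ⟨v, h⟩

variable (t₁ : RootedTree {v // v ∈ S}) (t₂ : RootedTree {v // v ∉ S})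

lemma joinMap_root : joinMap t₁ t₂ t₁.1.1 = t₂.1.1 := by
  simp [joinMap, t₁.1.1.2]

lemma joinMap_of_ne {v : {v // v ∈ S}} (hv : v ≠ t₁.1.1) :
    joinMap t₁ t₂ v = t₁.1.2 v := by
  have : (v : V) ≠ t₁.1.1 := fun h => hv (Subtype.ext h)
  simp [joinMap, v.2, this]

lemma joinMap_of_notMem (v : {v // v ∉ S}) : joinMap t₁ t₂ v = t₂.1.2 v := by
  simp [joinMap, v.2]

lemma isParentMap_joinMap : IsParentMap (joinMap t₁ t₂) t₂.1.1 := by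
  refine ⟨by rw [joinMap_of_notMem, t₂.2.1], fun v => ?_⟩
  by_cases hv : v ∈ S
  · obtain ⟨k, hk⟩ := t₁.2.2 ⟨v, hv⟩
    induction k generalizing v with
    | zero =>
      refine ⟨1, ?_⟩
      have : v = t₁.1.1 := congrArg Subtype.val hk
      rw [Function.iterate_one, this, joinMap_root]
    | succ k ih =>
      by_cases hr : (⟨v, hv⟩ : {v // v ∈ S}) = t₁.1.1
      · refine ⟨1, ?_⟩
        have : v = t₁.1.1 := congrArg Subtype.val hr
        rw [Function.iterate_one, this, joinMap_root]
      · obtain ⟨m, hm⟩ := ih (t₁.1.2 ⟨v, hv⟩) (t₁.1.2 ⟨v, hv⟩).2 hk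
        exact ⟨m + 1, by rwa [Function.iterate_succ_apply, joinMap_of_ne t₁ t₂ hr]⟩
  · obtain ⟨k, hk⟩ := t₂.2.2 ⟨v, hv⟩
    have hs : Function.Semiconj (Subtype.val : {v // v ∉ S} → V) t₂.1.2 (joinMap t₁ t₂) :=
      fun u => (joinMap_of_notMem t₁ t₂ u).symm
    exact ⟨k, by rw [← hk]; exact ((hs.iterate_right k) ⟨v, hv⟩).symm⟩

lemma isChild_joinMap : IsChild (joinMap t₁ t₂) t₁.1.1 t₂.1.1 :=
  ⟨joinMap_root t₁ t₂, fun h => t₂.1.1.2 (h ▸ t₁.1.1.2)⟩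

lemma childEmbedding_left :
    ChildEmbedding t₁.1.2 (joinMap t₁ t₂) Subtype.val fun _ => True where
  inj := Subtype.val_injective
  good_child _ _ _ _ := trivial
  isChild_iff w _ u := by
    constructor
    · rintro ⟨hp, hne⟩
      by_cases hu : u ∈ S
      · by_cases hr : (⟨u, hu⟩ : {v // v ∈ S}) = t₁.1.1
        · have hr' : u = t₁.1.1 := congrArg Subtype.val hr
          rw [hr', joinMap_root] at hp
          exact absurd w.2 (hp ▸ t₂.1.1.2)
        · refine ⟨⟨u, hu⟩, rfl, Subtype.ext ?_, fun h => hne (congrArg Subtype.val h)⟩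
          rw [← hp, ← joinMap_of_ne t₁ t₂ hr]
      · have := joinMap_of_notMem t₁ t₂ ⟨u, hu⟩
        exact absurd w.2 (hp ▸ this ▸ (t₁.1.2, t₂.1.2 ⟨u, hu⟩).2.2)
    · rintro ⟨w', rfl, hc⟩
      refine ⟨?_, fun h => hc.2 (Subtype.ext h)⟩
      rw [joinMap_of_ne t₁ t₂ (t₁.2.ne_root_of_isChild hc), hc.1]

lemma isChild_joinMap_iff_of_notMem {u : V} {w : {v // v ∉ S}} :
    IsChild (joinMap t₁ t₂) u w ↔
      (u = t₁.1.1 ∧ w = t₂.1.1) ∨ ∃ w' : {v // v ∉ S}, w' = u ∧ IsChild t₂.1.2 w' w := by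
  constructor
  · rintro ⟨hp, hne⟩
    by_cases hu : u ∈ S
    · by_cases hr : (⟨u, hu⟩ : {v // v ∈ S}) = t₁.1.1
      · have hr' : u = t₁.1.1 := congrArg Subtype.val hr
        rw [hr', joinMap_root] at hp
        exact .inl ⟨hr', (Subtype.ext hp).symm⟩
      · have := joinMap_of_ne t₁ t₂ hr
        exact absurd (hp ▸ this ▸ (t₁.1.2 ⟨u, hu⟩).2) w.2
    · exact .inr ⟨⟨u, hu⟩, rfl, Subtype.ext (by rw [← hp, ← joinMap_of_notMem t₁ t₂ ⟨u, hu⟩]),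
        fun h => hne (congrArg Subtype.val h)⟩
  · rintro (⟨rfl, rfl⟩ | ⟨w', rfl, hc⟩)
    · exact isChild_joinMap t₁ t₂
    · exact ⟨by rw [joinMap_of_notMem, hc.1], fun h => hc.2 (Subtype.ext h)⟩

lemma childEmbedding_right :
    ChildEmbedding t₂.1.2 (joinMap t₁ t₂) Subtype.val fun w => w ≠ t₂.1.1 where
  inj := Subtype.val_injective
  good_child _ _ _ hc := t₂.2.ne_root_of_isChild hc
  isChild_iff w hw u := by
    rw [isChild_joinMap_iff_of_notMem]
    simp [hw]

lemma isThread_joinMap_iff : IsThread (joinMap t₁ t₂) t₁.1.1 ↔ IsThread t₁.1.2 t₁.1.1 :=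
  (childEmbedding_left t₁ t₂).isThread_iff trivial

variable [Fintype V]

lemma numThread_joinMap : numThread (joinMap t₁ t₂) t₂.1.1 =
    numThread t₂.1.2 t₂.1.1 + if IsThread t₁.1.2 t₁.1.1 then 1 else 0 := by
  have hset : (Finset.univ.filter fun u =>
      IsChild (joinMap t₁ t₂) u t₂.1.1 ∧ IsThread (joinMap t₁ t₂) u) =
      ((Finset.univ.filter fun u => IsChild t₂.1.2 u t₂.1.1 ∧ IsThread t₂.1.2 u).map
        (Function.Embedding.subtype _)).disjUnion
      (if IsThread t₁.1.2 t₁.1.1 then {t₁.1.1.1} else ∅) (by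
        split_ifs
        · simp [t₁.1.1.2]
        · simp) := by
    ext u
    rw [Finset.mem_disjUnion, Finset.mem_map, Finset.mem_filter, isChild_joinMap_iff_of_notMem]
    simp only [Finset.mem_univ, true_and, and_true, Finset.mem_filter,
      Function.Embedding.subtype_apply]
    constructor
    · rintro ⟨rfl | ⟨w, rfl, hc⟩, ht⟩
      · rw [isThread_joinMap_iff] at ht
        simp [ht]
      · exact .inl ⟨w, ⟨hc, ((childEmbedding_right t₁ t₂).isThread_iff
          (t₂.2.ne_root_of_isChild hc)).1 ht⟩, rfl⟩
    · rintro (⟨w, ⟨hc, ht⟩, rfl⟩ | h)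
      · exact ⟨.inr ⟨w, rfl, hc⟩, ((childEmbedding_right t₁ t₂).isThread_iff
          (t₂.2.ne_root_of_isChild hc)).2 ht⟩
      · split_ifs at h with ht
        · obtain rfl := Finset.mem_singleton.1 h
          exact ⟨.inl rfl, (isThread_joinMap_iff t₁ t₂).2 ht⟩
        · simp at h
  rw [numThread, hset, Finset.card_disjUnion, Finset.card_map]
  congr 1
  split_ifs <;> simp

lemma numBranch_joinMap : numBranch (joinMap t₁ t₂) t₂.1.1 =
    numBranch t₂.1.2 t₂.1.1 + if IsThread t₁.1.2 t₁.1.1 then 0 else 1 := by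
  have hset : (Finset.univ.filter fun u =>
      IsChild (joinMap t₁ t₂) u t₂.1.1 ∧ ¬ IsThread (joinMap t₁ t₂) u) =
      ((Finset.univ.filter fun u => IsChild t₂.1.2 u t₂.1.1 ∧ ¬ IsThread t₂.1.2 u).map
        (Function.Embedding.subtype _)).disjUnion
      (if IsThread t₁.1.2 t₁.1.1 then ∅ else {t₁.1.1.1}) (by
        split_ifs
        · simp
        · simp [t₁.1.1.2]) := by
    ext u
    rw [Finset.mem_disjUnion, Finset.mem_map, Finset.mem_filter, isChild_joinMap_iff_of_notMem]
    simp only [Finset.mem_univ, true_and, and_true, Finset.mem_filter,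
      Function.Embedding.subtype_apply]
    constructor
    · rintro ⟨rfl | ⟨w, rfl, hc⟩, ht⟩
      · rw [isThread_joinMap_iff] at ht
        simp [ht]
      · exact .inl ⟨w, ⟨hc, fun h => ht (((childEmbedding_right t₁ t₂).isThread_iff
          (t₂.2.ne_root_of_isChild hc)).2 h)⟩, rfl⟩
    · rintro (⟨w, ⟨hc, ht⟩, rfl⟩ | h)
      · exact ⟨.inr ⟨w, rfl, hc⟩, fun h => ht (((childEmbedding_right t₁ t₂).isThread_iff
          (t₂.2.ne_root_of_isChild hc)).1 h)⟩
      · split_ifs at h with ht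
        · simp at h
        · obtain rfl := Finset.mem_singleton.1 h
          exact ⟨.inl rfl, fun h => ht ((isThread_joinMap_iff t₁ t₂).1 h)⟩
  rw [numBranch, hset, Finset.card_disjUnion, Finset.card_map]
  congr 1
  split_ifs <;> simp

lemma offRootCost_joinMap : offRootCost (joinMap t₁ t₂) t₂.1.1 =
    cost t₁.1.2 + offRootCost t₂.1.2 t₂.1.1 := by
  rw [offRootCost, ← Fintype.sum_subtype_add_sum_subtype (fun v => v ∈ S)]
  congr 1
  · refine Finset.sum_congr (Finset.ext fun _ => by simp) fun v _ => ?_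
    have hv : (v : V) ≠ t₂.1.1 := fun h => t₂.1.1.2 (h ▸ v.2)
    rw [if_neg hv, (childEmbedding_left t₁ t₂).numThread_eq trivial]
  · refine Finset.sum_congr rfl fun v _ => ?_
    by_cases hv : v = t₂.1.1
    · simp [hv]
    · rw [if_neg hv, if_neg fun h => hv (Subtype.ext h),
        (childEmbedding_right t₁ t₂).numThread_eq hv]

end Join

/-- Cutting the edge from the root to one of its children. -/
lemma joinMap_bijective (V : Type*) [Fintype V] : Function.Bijective
    (fun x : Σ S : Finset V, RootedTree {v // v ∈ S} × RootedTree {v // v ∉ S} =>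
      (⟨(⟨(x.2.2.1.1, joinMap x.2.1 x.2.2), isParentMap_joinMap _ _⟩, x.2.1.1.1),
        isChild_joinMap _ _⟩ : {x : RootedTree V × V // IsChild x.1.1.2 x.2 x.1.1.1})) := by
  constructor
  · rintro ⟨S, t₁, t₂⟩ ⟨S', t₁', t₂'⟩ h
    simp only [Subtype.mk.injEq, Prod.mk.injEq] at h
    obtain ⟨⟨hr, hp⟩, hs⟩ := h
    have hmem : ∀ (S : Finset V) (t₁ : RootedTree {v // v ∈ S}) (t₂ : RootedTree {v // v ∉ S})
        (v : V), v ∈ S ↔ IsBelow (joinMap t₁ t₂) v t₁.1.1 := fun S t₁ t₂ v =>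
      ⟨fun hv => ((childEmbedding_left t₁ t₂).isBelow_of_isBelow trivial
          (t₁.2.isBelow_root ⟨v, hv⟩)).2, fun hv => by
        obtain ⟨w, rfl, -⟩ := (childEmbedding_left t₁ t₂).exists_of_isBelow trivial hv
        exact w.2⟩
    obtain rfl : S = S' := Finset.ext fun v => by
      rw [hmem S t₁ t₂ v, hmem S' t₁' t₂' v, hp, hs]
    have hs' := Subtype.ext hs
    have h1 : t₁ = t₁' := by
      refine Subtype.ext (Prod.ext hs' (funext fun v => ?_))
      by_cases hv : v = t₁.1.1
      · rw [hv, t₁.2.1, hs', t₁'.2.1]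
      · refine Subtype.ext ?_
        rw [← joinMap_of_ne t₁ t₂ hv, ← joinMap_of_ne t₁' t₂' (hs' ▸ hv), hp]
    have h2 : t₂ = t₂' := by
      refine Subtype.ext (Prod.ext (Subtype.ext hr) (funext fun v => Subtype.ext ?_))
      rw [← joinMap_of_notMem t₁ t₂, ← joinMap_of_notMem t₁' t₂', hp]
    rw [h1, h2]
  · rintro ⟨⟨⟨⟨r, p⟩, h⟩, s⟩, hc⟩
    simp only at h hc
    let S : Finset V := Finset.univ.filter fun v => IsBelow p v s
    have hS : ∀ v, v ∈ S ↔ IsBelow p v s := by simp [S]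
    have hrS : r ∉ S := fun hr => h.not_isBelow_of_isChild hc ((hS r).1 hr)
    have hsS : s ∈ S := (hS s).2 (.refl s)
    let p₁ : {v // v ∈ S} → {v // v ∈ S} := fun v =>
      if hv : v.1 = s then ⟨s, hsS⟩ else
        ⟨p v, (hS _).2 (((hS _).1 v.2).parent_of_ne hv)⟩
    let p₂ : {v // v ∉ S} → {v // v ∉ S} := fun v =>
      ⟨p v, fun hv => v.2 ((hS _).2 ((isBelow_parent p v).trans ((hS _).1 hv)))⟩
    have h₁ : IsParentMap p₁ ⟨s, hsS⟩ := by
      refine ⟨by simp [p₁], fun v => ?_⟩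
      obtain ⟨k, hk⟩ := (hS _).1 v.2
      induction k generalizing v with
      | zero => exact ⟨0, Subtype.ext hk⟩
      | succ k ih =>
        by_cases hv : v.1 = s
        · exact ⟨0, Subtype.ext hv⟩
        · obtain ⟨m, hm⟩ := ih ⟨p v, (hS _).2 (((hS _).1 v.2).parent_of_ne hv)⟩ hk
          refine ⟨m + 1, ?_⟩
          rw [Function.iterate_succ_apply, ← hm]
          simp [p₁, hv]
    have h₂ : IsParentMap p₂ ⟨r, hrS⟩ := by
      refine ⟨Subtype.ext h.1, fun v => ?_⟩
      obtain ⟨k, hk⟩ := h.2 v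
      have hsc : Function.Semiconj (Subtype.val : {v // v ∉ S} → V) p₂ p := fun u => rfl
      exact ⟨k, Subtype.ext (((hsc.iterate_right k) v).trans hk)⟩
    refine ⟨⟨S, ⟨(⟨s, hsS⟩, p₁), h₁⟩, ⟨(⟨r, hrS⟩, p₂), h₂⟩⟩, ?_⟩
    simp only [Subtype.mk.injEq, Prod.mk.injEq, true_and, and_true]
    funext v
    by_cases hv : v ∈ S
    · by_cases hvs : v = s
      · simp [joinMap, hvs, hsS, hc.1]
      · simp [joinMap, hv, hvs, p₁]
    · simp [joinMap, hv, p₂]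

lemma sum_isChild_eq {V M : Type*} [Fintype V] [AddCommMonoid M] (Φ : RootedTree V → V → M) :
    ∑ t : RootedTree V, ∑ s with IsChild t.1.2 s t.1.1, Φ t s =
      ∑ S : Finset V, ∑ t₁ : RootedTree {v // v ∈ S}, ∑ t₂ : RootedTree {v // v ∉ S},
        Φ ⟨(t₂.1.1, joinMap t₁ t₂), isParentMap_joinMap t₁ t₂⟩ t₁.1.1 := by
  have h := (joinMap_bijective V).sum_comp fun x => Φ x.1.1 x.1.2
  rw [Fintype.sum_sigma] at h
  simp only [Fintype.sum_prod_type] at h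
  rw [h, ← Finset.sum_subtype (Finset.univ.filter fun x : RootedTree V × V =>
    IsChild x.1.1.2 x.2 x.1.1.1) (by simp) fun x => Φ x.1 x.2, Finset.sum_filter,
    Fintype.sum_prod_type]
  exact Finset.sum_congr rfl fun t _ => Finset.sum_filter _ _

open scoped NNReal ENNReal

/-- Weighted count of the rooted trees on `V` which are paths hanging from their root. -/
def threadSum (y : ℝ≥0) (V : Type*) [Fintype V] : ℝ≥0 :=
  ∑ t : RootedTree V, if IsThread t.1.2 t.1.1 then y ^ cost t.1.2 else 0

/-- Weighted count of the rooted trees on `V` which are not paths hanging from their root. -/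
def branchSum (y : ℝ≥0) (V : Type*) [Fintype V] : ℝ≥0 :=
  ∑ t : RootedTree V, if IsThread t.1.2 t.1.1 then 0 else y ^ cost t.1.2

/-- Count of the rooted trees on `V` by the types of the children of the root, where the root does
not contribute to the weight. -/
def rootSum (y : ℝ≥0) (k l : ℕ) (V : Type*) [Fintype V] : ℝ≥0 :=
  ∑ t : RootedTree V, if numThread t.1.2 t.1.1 = k ∧ numBranch t.1.2 t.1.1 = l
    then y ^ offRootCost t.1.2 t.1.1 else 0

section Congr

variable {V W : Type*} (e : V ≃ W)

lemma isParentMap_conj {p : V → V} {r : V} (h : IsParentMap p r) :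
    IsParentMap (e ∘ p ∘ e.symm) (e r) := by
  refine ⟨by simp [h.1], fun w => ?_⟩
  obtain ⟨k, hk⟩ := h.2 (e.symm w)
  have hs : Function.Semiconj e p (e ∘ p ∘ e.symm) := fun v => by simp
  exact ⟨k, by rw [← hk, (hs.iterate_right k) (e.symm w), e.apply_symm_apply]⟩

/-- Relabelling of rooted trees. -/
def relabel : RootedTree V ≃ RootedTree W where
  toFun t := ⟨(e t.1.1, e ∘ t.1.2 ∘ e.symm), isParentMap_conj e t.2⟩
  invFun t := ⟨(e.symm t.1.1, e.symm ∘ t.1.2 ∘ e), isParentMap_conj e.symm t.2⟩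
  left_inv t := Subtype.ext (Prod.ext (by simp) (by funext v; simp))
  right_inv t := Subtype.ext (Prod.ext (by simp) (by funext v; simp))

lemma childEmbedding_relabel (t : RootedTree V) :
    ChildEmbedding t.1.2 (relabel e t).1.2 e fun _ => True where
  inj := e.injective
  good_child _ _ _ _ := trivial
  isChild_iff w _ u := by
    constructor
    · rintro ⟨hp, hne⟩
      refine ⟨e.symm u, by simp, e.injective hp, fun h => hne (by simp [← h])⟩
    · rintro ⟨w', rfl, hc⟩
      exact ⟨by simp [relabel, hc.1], fun h => hc.2 (e.injective h)⟩

variable (t : RootedTree V)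

lemma isThread_relabel :
    IsThread (relabel e t).1.2 (relabel e t).1.1 ↔ IsThread t.1.2 t.1.1 :=
  (childEmbedding_relabel e t).isThread_iff trivial

variable [Fintype V] [Fintype W]

lemma cost_relabel : cost (relabel e t).1.2 = cost t.1.2 := by
  rw [cost, cost, ← e.sum_comp]
  exact Finset.sum_congr rfl fun v _ => by
    rw [(childEmbedding_relabel e t).numThread_eq trivial]

lemma numThread_relabel :
    numThread (relabel e t).1.2 (relabel e t).1.1 = numThread t.1.2 t.1.1 :=
  (childEmbedding_relabel e t).numThread_eq trivial

lemma numBranch_relabel :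
    numBranch (relabel e t).1.2 (relabel e t).1.1 = numBranch t.1.2 t.1.1 :=
  (childEmbedding_relabel e t).numBranch_eq trivial

lemma offRootCost_relabel :
    offRootCost (relabel e t).1.2 (relabel e t).1.1 = offRootCost t.1.2 t.1.1 := by
  have h1 := cost_eq_offRootCost_add t.1.2 t.1.1
  have h2 := cost_eq_offRootCost_add (relabel e t).1.2 (relabel e t).1.1
  rw [cost_relabel, numThread_relabel] at h2
  omega

end Congr

section CongrSum

variable {V W : Type*} [Fintype V] [Fintype W] (y : ℝ≥0)

lemma threadSum_congr (e : V ≃ W) : threadSum y V = threadSum y W :=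
  Fintype.sum_equiv (relabel e) _ _ fun t => by simp only [isThread_relabel, cost_relabel]

lemma branchSum_congr (e : V ≃ W) : branchSum y V = branchSum y W :=
  Fintype.sum_equiv (relabel e) _ _ fun t => by simp only [isThread_relabel, cost_relabel]

lemma rootSum_congr (k l : ℕ) (e : V ≃ W) : rootSum y k l V = rootSum y k l W :=
  Fintype.sum_equiv (relabel e) _ _ fun t => by
    simp only [numThread_relabel, numBranch_relabel, offRootCost_relabel]

end CongrSum

section Recursion

variable (y : ℝ≥0) (k l : ℕ) (V : Type*) [Fintype V]

lemma succ_mul_rootSum_thread : (k + 1) * rootSum y (k + 1) l V =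
    ∑ S : Finset V, threadSum y {v // v ∈ S} * rootSum y k l {v // v ∉ S} := by
  let Φ : RootedTree V → V → ℝ≥0 := fun t s => if IsThread t.1.2 s ∧
    numThread t.1.2 t.1.1 = k + 1 ∧ numBranch t.1.2 t.1.1 = l
    then y ^ offRootCost t.1.2 t.1.1 else 0
  have hl : ∀ t : RootedTree V, ((k + 1 : ℝ≥0) * if numThread t.1.2 t.1.1 = k + 1 ∧
      numBranch t.1.2 t.1.1 = l then y ^ offRootCost t.1.2 t.1.1 else 0) =
      ∑ s with IsChild t.1.2 s t.1.1, Φ t s := fun t => by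
    simp only [Φ]
    split_ifs with hc
    · simp only [hc, and_self, and_true]
      rw [← Finset.sum_filter, Finset.filter_filter, Finset.sum_const, nsmul_eq_mul]
      congr 1
      exact_mod_cast hc.1.symm
    · simp only [hc, and_false, if_false, Finset.sum_const_zero, mul_zero]
  have h1 : (k + 1) * rootSum y (k + 1) l V =
      ∑ t : RootedTree V, ∑ s with IsChild t.1.2 s t.1.1, Φ t s :=
    (Finset.mul_sum _ _ _).trans (Finset.sum_congr rfl fun t _ => hl t)
  rw [h1, sum_isChild_eq]
  refine Finset.sum_congr rfl fun S _ => ?_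
  have h2 : ∀ (t₁ : RootedTree {v // v ∈ S}) (t₂ : RootedTree {v // v ∉ S}),
      Φ ⟨(t₂.1.1, joinMap t₁ t₂), isParentMap_joinMap t₁ t₂⟩ t₁.1.1 =
      (if IsThread t₁.1.2 t₁.1.1 then y ^ cost t₁.1.2 else 0) *
        if numThread t₂.1.2 t₂.1.1 = k ∧ numBranch t₂.1.2 t₂.1.1 = l
          then y ^ offRootCost t₂.1.2 t₂.1.1 else 0 := fun t₁ t₂ => by
    simp only [Φ, numThread_joinMap, numBranch_joinMap, offRootCost_joinMap, isThread_joinMap_iff]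
    by_cases ht : IsThread t₁.1.2 t₁.1.1
    · simp [ht, pow_add]
    · simp [ht]
  simp only [h2]
  rw [threadSum, rootSum, Finset.sum_mul_sum]
  congr!

lemma succ_mul_rootSum_branch : (l + 1) * rootSum y k (l + 1) V =
    ∑ S : Finset V, branchSum y {v // v ∈ S} * rootSum y k l {v // v ∉ S} := by
  let Φ : RootedTree V → V → ℝ≥0 := fun t s => if ¬ IsThread t.1.2 s ∧
    numThread t.1.2 t.1.1 = k ∧ numBranch t.1.2 t.1.1 = l + 1
    then y ^ offRootCost t.1.2 t.1.1 else 0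
  have hl : ∀ t : RootedTree V, ((l + 1 : ℝ≥0) * if numThread t.1.2 t.1.1 = k ∧
      numBranch t.1.2 t.1.1 = l + 1 then y ^ offRootCost t.1.2 t.1.1 else 0) =
      ∑ s with IsChild t.1.2 s t.1.1, Φ t s := fun t => by
    simp only [Φ]
    split_ifs with hc
    · simp only [hc, and_self, and_true]
      rw [← Finset.sum_filter, Finset.filter_filter, Finset.sum_const, nsmul_eq_mul]
      congr 1
      exact_mod_cast hc.2.symm
    · simp only [hc, and_false, if_false, Finset.sum_const_zero, mul_zero]
  have h1 : (l + 1) * rootSum y k (l + 1) V =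
      ∑ t : RootedTree V, ∑ s with IsChild t.1.2 s t.1.1, Φ t s :=
    (Finset.mul_sum _ _ _).trans (Finset.sum_congr rfl fun t _ => hl t)
  rw [h1, sum_isChild_eq]
  refine Finset.sum_congr rfl fun S _ => ?_
  have h2 : ∀ (t₁ : RootedTree {v // v ∈ S}) (t₂ : RootedTree {v // v ∉ S}),
      Φ ⟨(t₂.1.1, joinMap t₁ t₂), isParentMap_joinMap t₁ t₂⟩ t₁.1.1 =
      (if IsThread t₁.1.2 t₁.1.1 then 0 else y ^ cost t₁.1.2) *
        if numThread t₂.1.2 t₂.1.1 = k ∧ numBranch t₂.1.2 t₂.1.1 = l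
          then y ^ offRootCost t₂.1.2 t₂.1.1 else 0 := fun t₁ t₂ => by
    simp only [Φ, numThread_joinMap, numBranch_joinMap, offRootCost_joinMap, isThread_joinMap_iff]
    by_cases ht : IsThread t₁.1.2 t₁.1.1
    · simp [ht]
    · simp [ht, pow_add]
  simp only [h2]
  rw [branchSum, rootSum, Finset.sum_mul_sum]
  congr!

variable {V} in
lemma isThread_root_iff {p : V → V} {r : V} (h : IsParentMap p r) :
    IsThread p r ↔ numThread p r ≤ 1 ∧ numBranch p r = 0 := by
  constructor
  · intro ht
    refine ⟨Finset.card_le_one.2 fun a ha b hb => ?_, Finset.card_eq_zero.2 <|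
      Finset.filter_eq_empty_iff.2 fun u _ hu => hu.2 (ht.of_isBelow (h.isBelow_root u))⟩
    simp only [Finset.mem_filter] at ha hb
    exact ht r (.refl r) a b ha.2.1 hb.2.1
  · rintro ⟨h1, h2⟩
    have hth : ∀ c, IsChild p c r → IsThread p c := fun c hc => by
      by_contra hn
      exact Finset.filter_eq_empty_iff.1 (Finset.card_eq_zero.1 h2) (Finset.mem_univ c) ⟨hc, hn⟩
    intro x hx a b ha hb
    by_cases hxr : x = r
    · subst hxr
      exact Finset.card_le_one.1 h1 a (by simpa using ⟨ha, hth a ha⟩) b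
        (by simpa using ⟨hb, hth b hb⟩)
    · obtain ⟨c, hc, hxc⟩ := hx.exists_isChild hxr
      exact hth c hc x hxc a b ha hb

lemma rootSum_zero_zero : rootSum y 0 0 V = if Fintype.card V = 1 then 1 else 0 := by
  have hroot : ∀ t : RootedTree V, numThread t.1.2 t.1.1 = 0 ∧ numBranch t.1.2 t.1.1 = 0 →
      Fintype.card V = 1 := fun t ht => by
    refine Fintype.card_eq_one_iff.2 ⟨t.1.1, fun v => ?_⟩
    by_contra hv
    obtain ⟨c, hc, -⟩ := (t.2.isBelow_root v).exists_isChild hv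
    by_cases hth : IsThread t.1.2 c
    · exact Finset.filter_eq_empty_iff.1 (Finset.card_eq_zero.1 ht.1) (Finset.mem_univ c) ⟨hc, hth⟩
    · exact Finset.filter_eq_empty_iff.1 (Finset.card_eq_zero.1 ht.2) (Finset.mem_univ c) ⟨hc, hth⟩
  split_ifs with h1
  · obtain ⟨r, hr⟩ := Fintype.card_eq_one_iff.1 h1
    have : Subsingleton V := ⟨fun a b => (hr a).trans (hr b).symm⟩
    have hchild : ∀ (p : V → V) (u v : V), ¬ IsChild p u v := fun p u v h =>
      h.2 (Subsingleton.elim u v)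
    let t₀ : RootedTree V := ⟨(r, id), rfl, fun v => ⟨0, hr v⟩⟩
    have : Unique (RootedTree V) := ⟨⟨t₀⟩, fun t => Subsingleton.elim _ _⟩
    rw [rootSum, Fintype.sum_unique]
    simp [numThread, numBranch, offRootCost, hchild]
  · exact Finset.sum_eq_zero fun t _ => if_neg fun ht => h1 (hroot t ht)

lemma threadSum_eq : threadSum y V = rootSum y 0 0 V + rootSum y 1 0 V := by
  rw [threadSum, rootSum, rootSum, ← Finset.sum_add_distrib]
  refine Finset.sum_congr rfl fun t _ => ?_
  have hcost := cost_eq_offRootCost_add t.1.2 t.1.1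
  simp only [isThread_root_iff t.2]
  by_cases hb : numBranch t.1.2 t.1.1 = 0
  · rcases Nat.lt_or_ge 1 (numThread t.1.2 t.1.1) with hn | hn
    · simp [show ¬ numThread t.1.2 t.1.1 ≤ 1 by omega, show numThread t.1.2 t.1.1 ≠ 0 by omega,
        show numThread t.1.2 t.1.1 ≠ 1 by omega]
    · have hc : cost t.1.2 = offRootCost t.1.2 t.1.1 := by omega
      rw [if_pos ⟨hn, hb⟩, hc]
      rcases Nat.le_one_iff_eq_zero_or_eq_one.1 hn with h | h <;> simp [h, hb]
  · simp [hb]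

lemma branchSum_eq : (branchSum y V : ℝ≥0∞) =
    ∑' k, ∑' l, (if k ≤ 1 ∧ l = 0 then 0 else (y : ℝ≥0∞) ^ (k - 1)) * rootSum y k l V := by
  have hpt : ∀ t : RootedTree V, ((if IsThread t.1.2 t.1.1 then 0 else y ^ cost t.1.2 : ℝ≥0) :
      ℝ≥0∞) = ∑' k, ∑' l, (if k ≤ 1 ∧ l = 0 then 0 else (y : ℝ≥0∞) ^ (k - 1)) *
        ((if numThread t.1.2 t.1.1 = k ∧ numBranch t.1.2 t.1.1 = l
          then y ^ offRootCost t.1.2 t.1.1 else 0 : ℝ≥0) : ℝ≥0∞) := fun t => by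
    rw [tsum_eq_single (numThread t.1.2 t.1.1) fun k hk => by simp [hk.symm],
      tsum_eq_single (numBranch t.1.2 t.1.1) fun l hl => by simp [hl.symm]]
    simp only [isThread_root_iff t.2, and_self, if_true]
    split_ifs
    · simp
    · rw [cost_eq_offRootCost_add t.1.2 t.1.1, pow_add, mul_comm]
      push_cast
      rfl
  simp only [branchSum, rootSum, ENNReal.ofNNReal_finsetSum, Finset.mul_sum]
  rw [Finset.sum_congr rfl fun t _ => hpt t,
    ← Summable.tsum_finsetSum fun _ _ => ENNReal.summable]
  exact tsum_congr fun k => (Summable.tsum_finsetSum fun _ _ => ENNReal.summable).symm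

end Recursion

open Finset.HasAntidiagonal

section TreeSystem

/-- The recursion satisfied by the terms of the exponential generating series of rooted trees, where
`T` and `B` are the series of the two types of trees and `A k l` is the series of the trees whose
root has `k` children of the first type and `l` of the second. -/
structure TreeSystem (w : ℕ → ℕ → ℝ≥0∞) (r : ℝ≥0∞) (T B : ℕ → ℝ≥0∞) (A : ℕ → ℕ → ℕ → ℝ≥0∞) :
    Prop where
  zero_zero : ∀ n, A 0 0 n = if n = 1 then r else 0
  apply_zero : ∀ k l, A k l 0 = 0
  succ_left : ∀ k l n, (k + 1) * A (k + 1) l n =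
    ∑ x ∈ antidiagonal n, T x.1 * A k l x.2
  succ_right : ∀ k l n, (l + 1) * A k (l + 1) n =
    ∑ x ∈ antidiagonal n, B x.1 * A k l x.2
  left_eq : ∀ n, T n = A 0 0 n + A 1 0 n
  right_eq : ∀ n, B n = ∑' k, ∑' l, w k l * A k l n

lemma tsum_sum_antidiagonal_mul (f g : ℕ → ℝ≥0∞) :
    ∑' n, ∑ x ∈ antidiagonal n, f x.1 * g x.2 = (∑' n, f n) * ∑' n, g n := by
  have h := sigmaAntidiagonalEquivProd.tsum_eq fun x : ℕ × ℕ => f x.1 * g x.2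
  rw [ENNReal.tsum_prod (f := fun a b => f a * g b)] at h
  simp only [ENNReal.tsum_mul_left, ENNReal.tsum_mul_right] at h
  rw [← h, ENNReal.tsum_sigma']
  refine tsum_congr fun n => ?_
  rw [tsum_fintype]
  exact (Finset.sum_coe_sort _ fun x : ℕ × ℕ => f x.1 * g x.2).symm

lemma sum_range_sum_antidiagonal_mul_le (f g : ℕ → ℝ≥0∞) (hg : g 0 = 0) (M : ℕ) :
    ∑ n ∈ Finset.range (M + 1), ∑ x ∈ antidiagonal n, f x.1 * g x.2 ≤
      (∑ n ∈ Finset.range M, f n) * ∑ n ∈ Finset.range (M + 1), g n := by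
  have h := tsum_sum_antidiagonal_mul (fun n => if n ∈ Finset.range M then f n else 0)
    fun n => if n ∈ Finset.range (M + 1) then g n else 0
  rw [tsum_eq_sum (s := Finset.range M) fun n hn => if_neg hn,
    tsum_eq_sum (s := Finset.range (M + 1)) fun n hn => if_neg hn,
    Finset.sum_ite_mem, Finset.sum_ite_mem, Finset.inter_self, Finset.inter_self] at h
  rw [← h]
  refine le_trans (Finset.sum_le_sum fun n hn => Finset.sum_le_sum fun x hx => ?_)
    (ENNReal.sum_le_tsum (Finset.range (M + 1)))
  rw [Finset.mem_range] at hn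
  rw [mem_antidiagonal] at hx
  by_cases h2 : x.2 = 0
  · simp [h2, hg]
  · simp [show x.1 < M by omega, show x.2 < M + 1 by omega]

lemma succ_mul_pow_div_factorial (x : ℝ≥0∞) (k : ℕ) :
    (k + 1) * (x ^ (k + 1) / (k + 1).factorial) = x * (x ^ k / k.factorial) := by
  have h1 : (k + 1 : ℝ≥0∞) ≠ 0 := by positivity
  have h2 : (k + 1 : ℝ≥0∞) ≠ ⊤ := by simp
  rw [Nat.factorial_succ, pow_succ', Nat.cast_mul, div_eq_mul_inv, div_eq_mul_inv,
    ENNReal.mul_inv (.inl (by exact_mod_cast h1)) (.inl (by simp))]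
  push_cast
  calc (k + 1 : ℝ≥0∞) * (x * x ^ k * ((k + 1 : ℝ≥0∞)⁻¹ * (k.factorial : ℝ≥0∞)⁻¹))
      = ((k + 1 : ℝ≥0∞) * (k + 1 : ℝ≥0∞)⁻¹) * (x * (x ^ k * (k.factorial : ℝ≥0∞)⁻¹)) := by ring
    _ = _ := by rw [ENNReal.mul_inv_cancel h1 h2, one_mul]

/-- The term of the generating function of trees with `k` and `l` children of the two types. -/
def rootTerm (r P N : ℝ≥0∞) (k l : ℕ) : ℝ≥0∞ :=
  r * (P ^ k / k.factorial) * (N ^ l / l.factorial)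

variable {r P N : ℝ≥0∞}

lemma succ_mul_rootTerm_left (k l : ℕ) :
    (k + 1) * rootTerm r P N (k + 1) l = P * rootTerm r P N k l := by
  have h := succ_mul_pow_div_factorial P k
  rw [rootTerm, rootTerm, ← mul_assoc, mul_left_comm, h]
  ring

lemma succ_mul_rootTerm_right (k l : ℕ) :
    (l + 1) * rootTerm r P N k (l + 1) = N * rootTerm r P N k l := by
  have h := succ_mul_pow_div_factorial N l
  rw [rootTerm, rootTerm, mul_left_comm, h]
  ring

lemma le_rootTerm {a : ℕ → ℕ → ℝ≥0∞} (h0 : a 0 0 ≤ r)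
    (h1 : ∀ k l, (k + 1) * a (k + 1) l ≤ P * a k l)
    (h2 : ∀ k l, (l + 1) * a k (l + 1) ≤ N * a k l) (k l : ℕ) : a k l ≤ rootTerm r P N k l := by
  have hc : ∀ (m : ℕ) (x z : ℝ≥0∞), (m + 1) * x ≤ (m + 1) * z → x ≤ z := fun m x z h =>
    (ENNReal.mul_le_mul_iff_right (by positivity) (by simp)).1 h
  induction l with
  | zero =>
    induction k with
    | zero => simpa [rootTerm] using h0
    | succ k ih =>
      refine hc k _ _ ((h1 k 0).trans ?_)
      rw [succ_mul_rootTerm_left]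
      gcongr
  | succ l ih =>
    refine hc l _ _ ((h2 k l).trans ?_)
    rw [succ_mul_rootTerm_right]
    gcongr

lemma eq_rootTerm {a : ℕ → ℕ → ℝ≥0∞} (h0 : a 0 0 = r)
    (h1 : ∀ k l, (k + 1) * a (k + 1) l = P * a k l)
    (h2 : ∀ k l, (l + 1) * a k (l + 1) = N * a k l) (k l : ℕ) : a k l = rootTerm r P N k l := by
  have hc : ∀ (m : ℕ) (x z : ℝ≥0∞), (m + 1) * x = (m + 1) * z → x = z := fun m x z h =>
    (ENNReal.mul_right_inj (by positivity) (by simp)).1 h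
  induction l with
  | zero =>
    induction k with
    | zero => simpa [rootTerm] using h0
    | succ k ih => exact hc k _ _ (by rw [h1, succ_mul_rootTerm_left, ih])
  | succ l ih => exact hc l _ _ (by rw [h2, succ_mul_rootTerm_right, ih])

namespace TreeSystem

variable {w : ℕ → ℕ → ℝ≥0∞} {T B : ℕ → ℝ≥0∞} {A : ℕ → ℕ → ℕ → ℝ≥0∞}

lemma tsum_eq_rootTerm (h : TreeSystem w r T B A) (k l : ℕ) :
    ∑' n, A k l n = rootTerm r (∑' n, T n) (∑' n, B n) k l := by
  refine eq_rootTerm (a := fun k l => ∑' n, A k l n) ?_ ?_ ?_ k l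
  · simp [h.zero_zero]
  · intro k l
    rw [← ENNReal.tsum_mul_left, ← tsum_sum_antidiagonal_mul]
    exact tsum_congr (h.succ_left k l)
  · intro k l
    rw [← ENNReal.tsum_mul_left, ← tsum_sum_antidiagonal_mul]
    exact tsum_congr (h.succ_right k l)

lemma tsum_left_eq (h : TreeSystem w r T B A) : ∑' n, T n = r + r * ∑' n, T n := by
  conv_lhs => rw [tsum_congr h.left_eq, ENNReal.tsum_add, h.tsum_eq_rootTerm, h.tsum_eq_rootTerm]
  simp [rootTerm]

lemma tsum_right_eq (h : TreeSystem w r T B A) :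
    ∑' n, B n = ∑' k, ∑' l, w k l * rootTerm r (∑' n, T n) (∑' n, B n) k l := by
  conv_lhs => rw [tsum_congr h.right_eq, ENNReal.tsum_comm]
  refine tsum_congr fun k => ?_
  rw [ENNReal.tsum_comm]
  exact tsum_congr fun l => by rw [ENNReal.tsum_mul_left, h.tsum_eq_rootTerm]

lemma tsum_le (h : TreeSystem w r T B A) (hP : r + r * P ≤ P)
    (hN : ∑' k, ∑' l, w k l * rootTerm r P N k l ≤ N) : ∑' n, T n ≤ P ∧ ∑' n, B n ≤ N := by
  suffices hM : ∀ M, ∑ n ∈ Finset.range M, T n ≤ P ∧ ∑ n ∈ Finset.range M, B n ≤ N from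
    ⟨ENNReal.tsum_le_of_sum_range_le fun M => (hM M).1,
      ENNReal.tsum_le_of_sum_range_le fun M => (hM M).2⟩
  intro M
  induction M with
  | zero => simp
  | succ M ih =>
    have hA : ∀ k l, ∑ n ∈ Finset.range (M + 1), A k l n ≤ rootTerm r P N k l := by
      refine le_rootTerm ?_ ?_ ?_
      · simp only [h.zero_zero, Finset.sum_ite_eq']
        split_ifs <;> simp
      · intro k l
        rw [Finset.mul_sum, Finset.sum_congr rfl fun n _ => h.succ_left k l n]
        exact (sum_range_sum_antidiagonal_mul_le _ _ (h.apply_zero k l) M).trans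
          (mul_le_mul_left ih.1 _)
      · intro k l
        rw [Finset.mul_sum, Finset.sum_congr rfl fun n _ => h.succ_right k l n]
        exact (sum_range_sum_antidiagonal_mul_le _ _ (h.apply_zero k l) M).trans
          (mul_le_mul_left ih.2 _)
    constructor
    · rw [Finset.sum_congr rfl fun n _ => h.left_eq n, Finset.sum_add_distrib]
      refine (add_le_add (hA 0 0) (hA 1 0)).trans (le_trans ?_ hP)
      simp [rootTerm]
    · rw [Finset.sum_congr rfl fun n _ => h.right_eq n,
        ← Summable.tsum_finsetSum fun _ _ => ENNReal.summable]
      refine le_trans (ENNReal.tsum_le_tsum fun k => ?_) hN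
      rw [← Summable.tsum_finsetSum fun _ _ => ENNReal.summable]
      refine ENNReal.tsum_le_tsum fun l => ?_
      rw [← Finset.mul_sum]
      gcongr
      exact hA k l

end TreeSystem

end TreeSystem

section Instance

variable (y r : ℝ≥0)

/-- The terms of the exponential generating series with coefficients `f`. -/
def egfTerm (f : ℕ → ℝ≥0) (n : ℕ) : ℝ≥0 := f n / n.factorial * r ^ n

lemma egfTerm_sum_finset (f g : ℕ → ℝ≥0) (n : ℕ) :
    egfTerm r (fun n => ∑ S : Finset (Fin n), f S.card * g (n - S.card)) n =
      ∑ x ∈ antidiagonal n, egfTerm r f x.1 * egfTerm r g x.2 := by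
  have h := Finset.sum_powerset_apply_card (fun m => f m * g (n - m))
    (x := (Finset.univ : Finset (Fin n)))
  rw [Finset.powerset_univ, Finset.card_univ, Fintype.card_fin] at h
  rw [egfTerm, h, Finset.Nat.sum_antidiagonal_eq_sum_range_succ
    (fun i j => egfTerm r f i * egfTerm r g j), Finset.sum_div, Finset.sum_mul]
  refine Finset.sum_congr rfl fun m hm => ?_
  have hmn : m ≤ n := Nat.lt_succ_iff.1 (Finset.mem_range.1 hm)
  have hc : (n.choose m : ℝ≥0) * m.factorial * (n - m).factorial = n.factorial := by
    exact_mod_cast Nat.choose_mul_factorial_mul_factorial hmn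
  have hr : r ^ n = r ^ m * r ^ (n - m) := by rw [← pow_add, Nat.add_sub_cancel' hmn]
  have h1 : (m.factorial : ℝ≥0) ≠ 0 := by positivity
  have h2 : ((n - m).factorial : ℝ≥0) ≠ 0 := by positivity
  have h3 : (n.choose m : ℝ≥0) ≠ 0 := by exact_mod_cast (Nat.choose_pos hmn).ne'
  rw [egfTerm, egfTerm, nsmul_eq_mul, ← hc, hr]
  field_simp

/-- The weight of a root with `k` and `l` children of the two types, if it is not the start of a
path. -/
def rootWeight (k l : ℕ) : ℝ≥0∞ := if k ≤ 1 ∧ l = 0 then 0 else (y : ℝ≥0∞) ^ (k - 1)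

lemma sum_card_eq {n : ℕ} (a b : ∀ (V : Type) [Fintype V], ℝ≥0)
    (ha : ∀ (V W : Type) [Fintype V] [Fintype W], V ≃ W → a V = a W)
    (hb : ∀ (V W : Type) [Fintype V] [Fintype W], V ≃ W → b V = b W) :
    ∑ S : Finset (Fin n), a {v // v ∈ S} * b {v // v ∉ S} =
      ∑ S : Finset (Fin n), a (Fin S.card) * b (Fin (n - S.card)) := by
  refine Finset.sum_congr rfl fun S _ => ?_
  rw [ha _ (Fin S.card) (Fintype.equivFinOfCardEq (by simp)),
    hb _ (Fin (n - S.card)) (Fintype.equivFinOfCardEq (by simp [Fintype.card_subtype_compl]))]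

lemma treeSystem : TreeSystem (rootWeight y) r
    (fun n => egfTerm r (fun n => threadSum y (Fin n)) n)
    (fun n => egfTerm r (fun n => branchSum y (Fin n)) n)
    (fun k l n => egfTerm r (fun n => rootSum y k l (Fin n)) n) where
  zero_zero n := by
    simp only [egfTerm, rootSum_zero_zero, Fintype.card_fin]
    split_ifs with h
    · simp [h]
    · simp
  apply_zero k l := by
    have : IsEmpty (RootedTree (Fin 0)) := ⟨fun t => t.1.1.elim0⟩
    simp [egfTerm, rootSum]
  succ_left k l n := by
    have h := egfTerm_sum_finset r (fun n => threadSum y (Fin n)) (fun n => rootSum y k l (Fin n)) n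
    have hs : (k + 1) * rootSum y (k + 1) l (Fin n) = _ :=
        (succ_mul_rootSum_thread y k l (Fin n)).trans <| by
      convert sum_card_eq (fun V _ => threadSum y V) (fun V _ => rootSum y k l V)
        (fun V W _ _ e => threadSum_congr y e) (fun V W _ _ e => rootSum_congr y k l e)
    rw [egfTerm, ← hs] at h
    have h' : (k + 1 : ℝ≥0) * egfTerm r (fun n => rootSum y (k + 1) l (Fin n)) n = _ :=
      Eq.trans (by rw [egfTerm]; ring) h
    exact_mod_cast h'
  succ_right k l n := by
    have h := egfTerm_sum_finset r (fun n => branchSum y (Fin n)) (fun n => rootSum y k l (Fin n)) n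
    have hs : (l + 1) * rootSum y k (l + 1) (Fin n) = _ :=
        (succ_mul_rootSum_branch y k l (Fin n)).trans <| by
      convert sum_card_eq (fun V _ => branchSum y V) (fun V _ => rootSum y k l V)
        (fun V W _ _ e => branchSum_congr y e) (fun V W _ _ e => rootSum_congr y k l e)
    rw [egfTerm, ← hs] at h
    have h' : (l + 1 : ℝ≥0) * egfTerm r (fun n => rootSum y k (l + 1) (Fin n)) n = _ :=
      Eq.trans (by rw [egfTerm]; ring) h
    exact_mod_cast h'
  left_eq n := by
    rw [← ENNReal.coe_add, egfTerm, egfTerm, egfTerm, threadSum_eq]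
    congr 1
    ring
  right_eq n := by
    have hm : ∀ a : ℝ≥0, ((a / n.factorial * r ^ n : ℝ≥0) : ℝ≥0∞) =
        a * ((1 / n.factorial * r ^ n : ℝ≥0) : ℝ≥0∞) := fun a => by
      rw [← ENNReal.coe_mul]
      congr 1
      ring
    rw [egfTerm, hm, branchSum_eq, ← ENNReal.tsum_mul_right]
    refine tsum_congr fun k => ?_
    rw [← ENNReal.tsum_mul_right]
    exact tsum_congr fun l => by rw [mul_assoc, ← hm, rootWeight, egfTerm]

end Instance

section Exp

lemma tsum_pow_div_factorial (x : ℝ≥0) :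
    ∑' n : ℕ, (x : ℝ≥0∞) ^ n / n.factorial = ENNReal.ofReal (Real.exp x) := by
  rw [Real.exp_eq_exp_ℝ, NormedSpace.exp_eq_tsum_div, ENNReal.ofReal_tsum_of_nonneg
    (fun n => by positivity) (Real.summable_pow_div_factorial _)]
  refine tsum_congr fun n => ?_
  rw [ENNReal.ofReal_div_of_pos (by positivity), ENNReal.ofReal_pow (by positivity)]
  simp

lemma tsum_pow_pred_mul_pow_div_factorial {y : ℝ≥0} (hy : 0 < y) (x : ℝ≥0) :
    ∑' n : ℕ, (y : ℝ≥0∞) ^ (n - 1) * ((x : ℝ≥0∞) ^ n / n.factorial) =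
      ENNReal.ofReal (1 + (Real.exp (y * x) - 1) / y) := by
  have h := tsum_pow_div_factorial (y * x)
  have hpos : (0 : ℝ) ≤ Real.exp (y * x) - 1 := by
    have := Real.one_le_exp (show (0 : ℝ) ≤ y * x by positivity)
    linarith
  rw [tsum_eq_zero_add' ENNReal.summable] at h ⊢
  have hy0 : (y : ℝ≥0∞) ≠ 0 := by exact_mod_cast hy.ne'
  have hs : (y : ℝ≥0∞) * ∑' n : ℕ, (y : ℝ≥0∞) ^ (n + 1 - 1) *
      ((x : ℝ≥0∞) ^ (n + 1) / (n + 1).factorial) = ENNReal.ofReal (Real.exp (y * x) - 1) := by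
    have he : Real.exp (y * x) = 1 + (Real.exp (y * x) - 1) := by ring
    rw [NNReal.coe_mul, he, ENNReal.ofReal_add zero_le_one hpos] at h
    simp only [pow_zero, Nat.factorial_zero, Nat.cast_one, div_one, ENNReal.ofReal_one] at h
    rw [← (ENNReal.add_right_inj ENNReal.one_ne_top).1 h, ← ENNReal.tsum_mul_left]
    refine tsum_congr fun n => ?_
    rw [ENNReal.coe_mul, mul_pow, Nat.add_sub_cancel, pow_succ (y : ℝ≥0∞), div_eq_mul_inv,
      div_eq_mul_inv]
    ring
  rw [ENNReal.ofReal_add zero_le_one (by positivity),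
    ENNReal.ofReal_div_of_pos (by exact_mod_cast hy), ← hs, ENNReal.ofReal_coe_nnreal,
    mul_comm (y : ℝ≥0∞), ENNReal.mul_div_cancel_right hy0 (by simp)]
  simp

lemma tsum_rootWeight {y : ℝ≥0} (hy : 0 < y) (r P N : ℝ≥0) :
    (r + r * P : ℝ≥0∞) + ∑' k, ∑' l, rootWeight y k l * rootTerm r P N k l =
      ENNReal.ofReal (r * (1 + (Real.exp (y * P) - 1) / y) * Real.exp N) := by
  have hpos : (0 : ℝ) ≤ 1 + (Real.exp (y * P) - 1) / y := by
    have := Real.one_le_exp (show (0 : ℝ) ≤ y * P by positivity)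
    have := div_nonneg (sub_nonneg.2 this) y.2
    linarith!
  rw [ENNReal.ofReal_mul (by positivity), ENNReal.ofReal_mul (by positivity),
    ENNReal.ofReal_coe_nnreal, ← tsum_pow_pred_mul_pow_div_factorial hy, ← tsum_pow_div_factorial]
  have hsplit : ∀ k l, (y : ℝ≥0∞) ^ (k - 1) * rootTerm r P N k l =
      (if k ≤ 1 ∧ l = 0 then rootTerm r P N k l else 0) +
        rootWeight y k l * rootTerm r P N k l := by
    intro k l
    rw [rootWeight]
    split_ifs with h
    · simp [show k - 1 = 0 by omega]
    · simp
  have hrest : ∑' k, ∑' l, (if k ≤ 1 ∧ l = 0 then rootTerm r P N k l else 0) =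
      (r + r * P : ℝ≥0∞) := by
    rw [tsum_eq_sum (s := Finset.range 2), Finset.sum_range_succ, Finset.sum_range_one,
      tsum_eq_single 0, tsum_eq_single 0]
    · simp [rootTerm]
    · intro l hl
      simp [hl]
    · intro l hl
      simp [hl]
    · intro k hk
      simp [show ¬ k ≤ 1 by simpa using hk]
  rw [← hrest, ← ENNReal.tsum_add]
  simp only [← ENNReal.tsum_add, ← hsplit]
  rw [mul_assoc, ← ENNReal.tsum_mul_right, ← ENNReal.tsum_mul_left]
  refine tsum_congr fun k => ?_
  rw [← ENNReal.tsum_mul_left, ← ENNReal.tsum_mul_left]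
  exact tsum_congr fun l => by rw [rootTerm]; ring

end Exp

section TreeSum

/-- Weighted count of the trees on the vertex set `V`. -/
def treeSum (y : ℝ≥0) (V : Type*) [Fintype V] : ℝ≥0 :=
  ∑ T : {G : SimpleGraph V // IsTree G}, y ^ metricDim T.1

lemma coe_treeSum (y : ℝ≥0) (V : Type*) [Fintype V] :
    (treeSum y V : ℝ) = ∑ᶠ T : {G : SimpleGraph V // IsTree G}, (y : ℝ) ^ metricDim T.1 := by
  rw [treeSum, finsum_eq_sum_of_fintype]
  push_cast
  rfl

lemma treeCoeff_eq (y : ℝ≥0) (n : ℕ) : treeCoeff y n = treeSum y (Fin n) / n.factorial := by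
  rw [treeCoeff, coe_treeSum]

variable (y : ℝ≥0) (V : Type*) [Fintype V]

lemma treeSum_le_mul : treeSum y V ≤ Fintype.card V * treeSum y V := by
  rcases isEmpty_or_nonempty V with hV | hV
  · have : IsEmpty {G : SimpleGraph V // IsTree G} := ⟨fun T => not_isEmpty_iff.2 T.2.1.nonempty hV⟩
    simp [treeSum]
  · exact le_mul_of_one_le_left zero_le (by exact_mod_cast Fintype.card_pos)

lemma card_mul_treeSum : Fintype.card V * treeSum y V =
    ∑ t : RootedTree V, y ^ metricDim (toGraph t.1.2) := by
  have h : ∑ t : RootedTree V, y ^ metricDim (toGraph t.1.2) =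
      ∑ r : V, ∑ p : {p : V → V // IsParentMap p r}, y ^ metricDim (toGraph p.1) := by
    let e : RootedTree V ≃ Σ r : V, {p : V → V // IsParentMap p r} :=
      ⟨fun t => ⟨t.1.1, t.1.2, t.2⟩, fun x => ⟨(x.1, x.2.1), x.2.2⟩, fun _ => rfl, fun _ => rfl⟩
    rw [← Fintype.sum_sigma' fun (r : V) (p : {p : V → V // IsParentMap p r}) =>
      y ^ metricDim (toGraph p.1)]
    exact Fintype.sum_equiv e _ _ fun _ => rfl
  rw [h, Finset.sum_congr rfl fun r _ => (sum_isTree_eq (fun G => y ^ metricDim G) r).symm]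
  simp [treeSum]

lemma threadSum_add_branchSum :
    threadSum y V + branchSum y V = ∑ t : RootedTree V, y ^ cost t.1.2 := by
  rw [threadSum, branchSum, ← Finset.sum_add_distrib]
  exact Finset.sum_congr rfl fun t _ => by split_ifs <;> simp

lemma card_mul_treeSum_le :
    Fintype.card V * treeSum y V ≤ max 1 y * (threadSum y V + branchSum y V) := by
  rw [card_mul_treeSum, threadSum_add_branchSum, Finset.mul_sum]
  refine Finset.sum_le_sum fun t _ => ?_
  have h1 := t.2.cost_le_metricDim
  have h2 := t.2.metricDim_le
  rcases (show metricDim (toGraph t.1.2) = cost t.1.2 ∨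
    metricDim (toGraph t.1.2) = cost t.1.2 + 1 by omega) with h | h
  · rw [h]
    exact le_mul_of_one_le_left zero_le (le_max_left _ _)
  · rw [h, pow_succ']
    gcongr
    exact le_max_right _ _

lemma le_card_mul_treeSum :
    min 1 y * (threadSum y V + branchSum y V) ≤ Fintype.card V * treeSum y V := by
  rw [card_mul_treeSum, threadSum_add_branchSum, Finset.mul_sum]
  refine Finset.sum_le_sum fun t _ => ?_
  have h1 := t.2.cost_le_metricDim
  have h2 := t.2.metricDim_le
  rcases (show metricDim (toGraph t.1.2) = cost t.1.2 ∨
    metricDim (toGraph t.1.2) = cost t.1.2 + 1 by omega) with h | h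
  · rw [h]
    exact mul_le_of_le_one_left zero_le (min_le_left _ _)
  · rw [h, pow_succ']
    gcongr
    exact min_le_right _ _

end TreeSum

section Series

variable (y r : ℝ≥0)

/-- The sum of the exponential generating series of rooted trees which are paths. -/
def threadSeries : ℝ≥0∞ := ∑' n, (egfTerm r (fun n => threadSum y (Fin n)) n : ℝ≥0∞)

/-- The sum of the exponential generating series of rooted trees which are not paths. -/
def branchSeries : ℝ≥0∞ := ∑' n, (egfTerm r (fun n => branchSum y (Fin n)) n : ℝ≥0∞)

/-- The function whose level `1 / e` determines the singularity. -/
def levelFun (y p : ℝ) : ℝ := p / (1 + p) * (1 + (Real.exp (y * p) - 1) / y) * Real.exp (-p)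

variable {y r}

lemma series_ne_top {P : ℝ≥0} (hy : 0 < y) (hr : (r : ℝ) = P / (1 + P)) (hP : P ≤ 1)
    (h : levelFun y P ≤ (Real.exp 1)⁻¹) : threadSeries y r ≠ ⊤ ∧ branchSeries y r ≠ ⊤ := by
  have hP' : (r + r * P : ℝ≥0∞) = P := by
    have : (r + r * P : ℝ) = P := by
      rw [hr]
      have : (1 + P : ℝ) ≠ 0 := by positivity
      field_simp
    exact_mod_cast this
  have hN : ∑' k, ∑' l, rootWeight y k l * rootTerm r P (1 - P : ℝ≥0) k l ≤ (1 - P : ℝ≥0) := by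
    have hw := tsum_rootWeight hy r P (1 - P)
    rw [hP'] at hw
    refine (ENNReal.add_le_add_iff_left (a := P) (by simp)).1 ?_
    rw [hw, ← ENNReal.coe_add, add_tsub_cancel_of_le hP, ENNReal.coe_one, ← ENNReal.ofReal_one]
    refine ENNReal.ofReal_le_ofReal ?_
    rw [NNReal.coe_sub hP, NNReal.coe_one, sub_eq_neg_add 1, Real.exp_add, hr, ← mul_assoc]
    exact (le_div_iff₀ (Real.exp_pos 1)).1 (by rw [one_div]; exact h)
  have := (treeSystem y r).tsum_le hP'.le hN
  exact ⟨ne_top_of_le_ne_top (by simp) this.1, ne_top_of_le_ne_top (by simp) this.2⟩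

lemma levelFun_le {P : ℝ≥0} (hy : 0 < y) (hr : (r : ℝ) = P / (1 + P))
    (hT : threadSeries y r ≠ ⊤) (hB : branchSeries y r ≠ ⊤) :
    levelFun y P ≤ (Real.exp 1)⁻¹ := by
  have hsys := treeSystem y r
  have h1 := hsys.tsum_left_eq
  have h2 := hsys.tsum_right_eq
  change threadSeries y r = r + r * threadSeries y r at h1
  change branchSeries y r = ∑' k, ∑' l, rootWeight y k l *
    rootTerm r (threadSeries y r) (branchSeries y r) k l at h2
  lift threadSeries y r to ℝ≥0 using hT with Q
  lift branchSeries y r to ℝ≥0 using hB with N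
  have hQ : (Q : ℝ) = r + r * Q := by exact_mod_cast h1
  have hQP : Q = P := by
    have h0 : (1 + P : ℝ) ≠ 0 := by positivity
    rw [hr] at hQ
    field_simp at hQ
    exact NNReal.coe_injective (by linarith)
  subst hQP
  have hw := tsum_rootWeight hy r Q N
  rw [← h2, ← h1, ← ENNReal.coe_add, ENNReal.ofReal, ENNReal.coe_inj] at hw
  have hw' : (Q + N : ℝ) = r * (1 + (Real.exp (y * Q) - 1) / y) * Real.exp N := by
    have h0 : 0 ≤ (r : ℝ) * (1 + (Real.exp (y * Q) - 1) / y) * Real.exp N := by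
      have := Real.one_le_exp (show (0 : ℝ) ≤ y * Q by positivity)
      have := div_nonneg (sub_nonneg.2 this) y.2
      have : (0 : ℝ) ≤ 1 + (Real.exp (y * Q) - 1) / y := by linarith!
      positivity
    rw [← Real.coe_toNNReal _ h0, ← hw]
    push_cast
    rfl
  have hlev : levelFun y Q = (Q + N) * Real.exp (-(Q + N)) := by
    rw [neg_add, Real.exp_add, hw', levelFun, hr, Real.exp_neg (N : ℝ)]
    field_simp
  rw [hlev, Real.exp_neg, ← div_eq_mul_inv, div_le_iff₀ (Real.exp_pos _), ← Real.exp_neg,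
    ← Real.exp_add]
  have := Real.add_one_le_exp (-1 + (Q + N : ℝ))
  linarith

lemma summable_treeCoeff (hT : threadSeries y r ≠ ⊤) (hB : branchSeries y r ≠ ⊤) :
    Summable fun n : ℕ => |treeCoeff y n| * (r : ℝ) ^ n := by
  have hs := ((ENNReal.tsum_coe_ne_top_iff_summable.1 hT).add
    (ENNReal.tsum_coe_ne_top_iff_summable.1 hB)).mul_left (max 1 y)
  refine (NNReal.summable_coe.2 hs).of_nonneg_of_le (fun n => by positivity) fun n => ?_
  have h := (treeSum_le_mul y (Fin n)).trans (card_mul_treeSum_le y (Fin n))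
  rw [treeCoeff_eq, abs_of_nonneg (by positivity)]
  have h' : treeSum y (Fin n) / n.factorial * r ^ n ≤ max 1 y *
      (egfTerm r (fun n => threadSum y (Fin n)) n +
        egfTerm r (fun n => branchSum y (Fin n)) n) := by
    rw [egfTerm, egfTerm, ← add_mul, ← add_div, ← mul_assoc, ← mul_div_assoc]
    gcongr
  exact_mod_cast h'

lemma series_ne_top_of_summable {s : ℝ} (hy : 0 < y) (hrs : r < s)
    (h : Summable fun n : ℕ => |treeCoeff y n| * s ^ n) :
    threadSeries y r ≠ ⊤ ∧ branchSeries y r ≠ ⊤ := by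
  have hs : 0 < s := r.2.trans_lt hrs
  obtain ⟨K, hK⟩ := h.tendsto_atTop_zero.bddAbove_range
  have hgeo : Summable fun n : ℕ => (n : ℝ) ^ 1 * (r / s) ^ n :=
    summable_pow_mul_geometric_of_norm_lt_one 1 (by
      rw [Real.norm_of_nonneg (by positivity)]
      exact (div_lt_one hs).2 hrs)
  have hsum : Summable fun n : ℕ => ((n * treeSum y (Fin n) / n.factorial * r ^ n : ℝ≥0) : ℝ) := by
    refine (hgeo.mul_left K).of_nonneg_of_le (fun n => by positivity) fun n => ?_
    have hn := hK ⟨n, rfl⟩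
    simp only at hn
    rw [treeCoeff_eq, abs_of_nonneg (by positivity)] at hn
    push_cast
    calc (n * treeSum y (Fin n) / n.factorial * r ^ n : ℝ)
        = treeSum y (Fin n) / n.factorial * s ^ n * ((n : ℝ) ^ 1 * (r / s) ^ n) := by
          rw [div_pow]
          field_simp
      _ ≤ K * ((n : ℝ) ^ 1 * (r / s) ^ n) := by gcongr
  have hmin : 0 < min 1 y := lt_min one_pos hy
  have hsum' := (NNReal.summable_coe.1 hsum).mul_left (min 1 y)⁻¹
  have hle : ∀ n : ℕ, egfTerm r (fun n => threadSum y (Fin n)) n +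
      egfTerm r (fun n => branchSum y (Fin n)) n ≤
      (min 1 y)⁻¹ * (n * treeSum y (Fin n) / n.factorial * r ^ n) := fun n => by
    rw [egfTerm, egfTerm, ← add_mul, ← add_div, le_inv_mul_iff₀ hmin, ← mul_assoc, ← mul_div_assoc]
    have hn := le_card_mul_treeSum y (Fin n)
    rw [Fintype.card_fin] at hn
    exact mul_le_mul_left (div_le_div_of_nonneg_right hn zero_le) _
  exact ⟨ENNReal.tsum_coe_ne_top_iff_summable.2
      (NNReal.summable_of_le (fun n => le_self_add.trans (hle n)) hsum'),
    ENNReal.tsum_coe_ne_top_iff_summable.2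
      (NNReal.summable_of_le (fun n => le_add_self.trans (hle n)) hsum')⟩

end Series

section Real

lemma strictMonoOn_levelFun {y : ℝ} (hy : |y - 1| < 1 / 10) :
    StrictMonoOn (levelFun y) (Set.Icc 0 1) := by
  obtain ⟨d, rfl⟩ : ∃ d, y = 1 + d := ⟨y - 1, by ring⟩
  rw [add_sub_cancel_left, abs_lt] at hy
  obtain ⟨hd1, hd2⟩ := hy
  have hy0 : (0 : ℝ) < 1 + d := by linarith
  let F : ℝ → ℝ := fun p => p / (1 + p) * (d * Real.exp (-p) + Real.exp (d * p))
  have hF : ∀ p, levelFun (1 + d) p = (1 + d)⁻¹ * F p := fun p => by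
    have he : Real.exp ((1 + d) * p) * Real.exp (-p) = Real.exp (d * p) := by
      rw [← Real.exp_add]
      ring_nf
    simp only [levelFun, F, ← he]
    field_simp
    ring
  suffices hmono : StrictMonoOn F (Set.Icc 0 1) from fun a ha b hb hab => by
    rw [hF, hF]
    exact mul_lt_mul_of_pos_left (hmono ha hb hab) (by positivity)
  have hderiv : ∀ p ∈ Set.Icc (0 : ℝ) 1, HasDerivAt F
      (1 / (1 + p) ^ 2 * (d * Real.exp (-p) + Real.exp (d * p)) +
        p / (1 + p) * (d * (Real.exp (d * p) - Real.exp (-p)))) p := fun p hp => by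
    have hp0 : (1 + p : ℝ) ≠ 0 := by linarith [hp.1]
    have h1 : HasDerivAt (fun p : ℝ => p / (1 + p)) (1 / (1 + p) ^ 2) p :=
      ((hasDerivAt_id' p).fun_div ((hasDerivAt_id' p).const_add 1) hp0).congr_deriv (by ring)
    have h2 : HasDerivAt (fun p : ℝ => d * Real.exp (-p) + Real.exp (d * p))
        (d * (Real.exp (d * p) - Real.exp (-p))) p :=
      (((hasDerivAt_neg p).exp.const_mul d).fun_add
        ((hasDerivAt_id' p).const_mul d).exp).congr_deriv (by ring)
    exact h1.mul h2
  refine strictMonoOn_of_deriv_pos (convex_Icc 0 1)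
    (fun p hp => (hderiv p hp).continuousAt.continuousWithinAt) fun p hp => ?_
  rw [interior_Icc] at hp
  rw [(hderiv p ⟨hp.1.le, hp.2.le⟩).deriv]
  obtain ⟨hp1, hp2⟩ := hp
  have ha1 : Real.exp (-p) ≤ 1 := Real.exp_le_one_iff.2 (by linarith)
  have ha0 := Real.exp_pos (-p)
  have hb1 : 9 / 10 ≤ Real.exp (d * p) := by
    have := Real.add_one_le_exp (d * p)
    nlinarith
  have hb2 : Real.exp (d * p) ≤ 2 := by
    have h1 := Real.add_one_le_exp (-(d * p))
    have h2 : Real.exp (d * p) * Real.exp (-(d * p)) = 1 := by rw [← Real.exp_add]; simp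
    have h3 : 1 / 2 ≤ Real.exp (-(d * p)) := by nlinarith
    nlinarith [Real.exp_pos (d * p)]
  set a := Real.exp (-p)
  set b := Real.exp (d * p)
  have hm : 8 / 10 ≤ d * a + b := by nlinarith
  have hq : -(2 / 10) ≤ d * (b - a) := by
    rcases le_total 0 (b - a) with h | h <;> nlinarith
  have hkey : 0 < (d * a + b) + p * (1 + p) * (d * (b - a)) := by
    have : p * (1 + p) ≤ 2 := by nlinarith
    nlinarith [mul_pos hp1 (show (0 : ℝ) < 1 + p by linarith)]
  have : 1 / (1 + p) ^ 2 * (d * a + b) + p / (1 + p) * (d * (b - a)) =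
      ((d * a + b) + p * (1 + p) * (d * (b - a))) / (1 + p) ^ 2 := by
    field_simp
  rw [this]
  positivity

/-- The radius of convergence in terms of a solution of the equation for the singularity. -/
lemma summable_iff_of_levelFun_eq {y q : ℝ} (hy : |y - 1| < 1 / 10) (hq0 : 0 < q) (hq1 : q < 1)
    (hq : levelFun y q = (Real.exp 1)⁻¹) {r : ℝ} (hr : 0 ≤ r) :
    (r < q / (1 + q) → Summable fun n : ℕ => |treeCoeff y n| * r ^ n) ∧
      (q / (1 + q) < r → ¬ Summable fun n : ℕ => |treeCoeff y n| * r ^ n) := by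
  have hmono := strictMonoOn_levelFun hy
  have hy0 : 0 < y := by linarith [(abs_lt.1 hy).1]
  have hqhalf : q / (1 + q) < 1 / 2 := by
    rw [div_lt_div_iff₀ (by linarith) two_pos]
    linarith
  have hinv : ∀ s : ℝ, s < 1 / 2 → s = s / (1 - s) / (1 + s / (1 - s)) := fun s hs => by
    have : (1 - s : ℝ) ≠ 0 := by linarith
    field_simp
    ring
  have hlt1 : ∀ s : ℝ, s < 1 / 2 → s / (1 - s) < 1 := fun s hs => by
    rw [div_lt_one (by linarith)]
    linarith
  lift y to ℝ≥0 using hy0.le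
  constructor
  · intro hlt
    have h2 : r < 1 / 2 := hlt.trans hqhalf
    have hP0 : 0 ≤ r / (1 - r) := div_nonneg hr (by linarith)
    have hPq : r / (1 - r) < q := by
      rw [lt_div_iff₀ (by linarith)] at hlt
      rw [div_lt_iff₀ (by linarith)]
      linarith
    have hr' := hinv r h2
    lift r to ℝ≥0 using hr
    lift (r : ℝ) / (1 - r) to ℝ≥0 using hP0 with P
    obtain ⟨hT, hB⟩ := series_ne_top (by exact_mod_cast hy0) hr'
      (by exact_mod_cast (hPq.trans hq1).le)
      (hq ▸ (hmono ⟨P.2, (hPq.trans hq1).le⟩ ⟨hq0.le, hq1.le⟩ hPq).le)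
    exact summable_treeCoeff hT hB
  · intro hlt hsum
    obtain ⟨s, hs1, hs2⟩ := exists_between (lt_min hlt hqhalf)
    obtain ⟨hsr, hs2⟩ := lt_min_iff.1 hs2
    have hs0 : 0 ≤ s := (div_pos hq0 (by linarith)).le.trans hs1.le
    have hP0 : 0 ≤ s / (1 - s) := div_nonneg hs0 (by linarith)
    have hPq : q < s / (1 - s) := by
      rw [div_lt_iff₀ (by linarith)] at hs1
      rw [lt_div_iff₀ (by linarith)]
      linarith
    have hP1 := hlt1 s hs2
    have hs' := hinv s hs2
    lift s to ℝ≥0 using hs0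
    lift (s : ℝ) / (1 - s) to ℝ≥0 using hP0 with P
    have hy0' : 0 < y := by exact_mod_cast hy0
    obtain ⟨hT, hB⟩ := series_ne_top_of_summable hy0' hsr hsum
    have h1 := levelFun_le hy0' hs' hT hB
    have h2 := hmono ⟨hq0.le, hq1.le⟩ ⟨P.2, hP1.le⟩ hPq
    exact (h1.trans hq.ge).not_gt h2

end Real

/-- for real `y` close enough to `1`, the radius of convergence of the power
series `T(·,y)` equals `R(y) = ρ(y)/(1+ρ(y))`; in particular for `y = 1` it equals `1/e`.
The radius is characterized by (absolute) summability of `aₙ rⁿ` for `r` below it and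
non-summability above it. -/
theorem tree_gf_radius (ρ : ℝ → ℝ) (hρan : AnalyticAt ℝ ρ 1)
    (hρ1 : ρ 1 = 1 / (Real.exp 1 - 1))
    (hρeq : ∀ᶠ y in 𝓝 (1 : ℝ),
      1 + ρ y = (1 + (Real.exp (y * ρ y) - 1) / y) * ρ y * Real.exp (1 - ρ y)) :
    (∃ ε : ℝ, 0 < ε ∧ ∀ y : ℝ, 0 < y → |y - 1| < ε → ∀ r : ℝ, 0 ≤ r →
      (r < ρ y / (1 + ρ y) → Summable fun n : ℕ => |treeCoeff y n| * r ^ n) ∧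
      (ρ y / (1 + ρ y) < r → ¬ Summable fun n : ℕ => |treeCoeff y n| * r ^ n)) ∧
    (∀ r : ℝ, 0 ≤ r →
      (r < (Real.exp 1)⁻¹ → Summable fun n : ℕ => |treeCoeff 1 n| * r ^ n) ∧
      ((Real.exp 1)⁻¹ < r → ¬ Summable fun n : ℕ => |treeCoeff 1 n| * r ^ n)) := by
  have he : 2 < Real.exp 1 := by linarith [Real.exp_one_gt_d9]
  have hρ0 : 0 < ρ 1 := by
    rw [hρ1]
    exact one_div_pos.2 (by linarith)
  have hρlt : ρ 1 < 1 := by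
    rw [hρ1, div_lt_one (by linarith)]
    linarith
  have hcont := hρan.continuousAt
  obtain ⟨ε, hε, H⟩ := Metric.eventually_nhds_iff.1 ((hρeq.and (hcont.eventually_const_lt hρ0)).and
    ((hcont.eventually_lt_const hρlt).and
      (Metric.ball_mem_nhds (1 : ℝ) (show (0 : ℝ) < 1 / 10 by norm_num))))
  have hmain : ∀ y : ℝ, |y - 1| < ε → ∀ r : ℝ, 0 ≤ r →
      (r < ρ y / (1 + ρ y) → Summable fun n : ℕ => |treeCoeff y n| * r ^ n) ∧
      (ρ y / (1 + ρ y) < r → ¬ Summable fun n : ℕ => |treeCoeff y n| * r ^ n) := by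
    intro y hyε r hr
    obtain ⟨⟨heq, h0⟩, h1, hy⟩ := H (by rwa [Real.dist_eq])
    rw [Real.dist_eq] at hy
    refine summable_iff_of_levelFun_eq hy h0 h1 ?_ hr
    rw [sub_eq_neg_add 1 (ρ y), Real.exp_add] at heq
    refine eq_inv_of_mul_eq_one_left ?_
    rw [levelFun, div_mul_eq_mul_div, div_mul_eq_mul_div, div_mul_eq_mul_div,
      div_eq_one_iff_eq (by linarith)]
    linear_combination -heq
  refine ⟨⟨ε, hε, fun y _ => hmain y⟩, ?_⟩
  have hR : ρ 1 / (1 + ρ 1) = (Real.exp 1)⁻¹ := by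
    have h1 : Real.exp 1 - 1 ≠ 0 := by linarith
    rw [hρ1]
    field_simp
    ring
  simpa only [hR] using hmain 1 (by simpa using hε)

end MetricDimPaper
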